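/- arXiv:0910.4446 — 9 statements merged into one kernel-verified Lean document; each statement's English description precedes it below -/
import Mathlib

section
/- Let M ⊆ ℝ^d be relatively dense. Then M is a Meyer set if and only if the subgroup [M] of (ℝ^d, +) generated by M is finitely generated and M has the linear approximation property, i.e., for every additive group homomorphism f : [M] → ℝ^m (any m) there exists an ℝ-linear map F : ℝ^d → ℝ^m such that the norm ‖F(x) − f(x)‖ is uniformly bounded over x ∈ M. -/
open scoped Pointwise

/-- A set is relatively dense if there is `R > 0` such that every closed ball
of radius `R` meets the set. -/
def RelativelyDense {d : ℕ} (M : Set (EuclideanSpace ℝ (Fin d))) : Prop :=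
  ∃ R > (0 : ℝ), ∀ y : EuclideanSpace ℝ (Fin d), ∃ x ∈ M, dist x y ≤ R

/-- A set is uniformly discrete if distinct points are at distance at least `r > 0`. -/
def UniformlyDiscrete {d : ℕ} (S : Set (EuclideanSpace ℝ (Fin d))) : Prop :=
  ∃ r > (0 : ℝ), ∀ x ∈ S, ∀ y ∈ S, x ≠ y → r ≤ dist x y

/-- A Meyer set: relatively dense with uniformly discrete difference set. -/
def IsMeyer {d : ℕ} (M : Set (EuclideanSpace ℝ (Fin d))) : Prop :=
  RelativelyDense M ∧ UniformlyDiscrete (M - M)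

/-- If `a` and `b` are joined by a chain inside a finite set along which `g` moves by steps of
length at most `δ`, then `g a` and `g b` are at distance at most `s.card * δ`. -/
theorem dist_le_card_mul_of_reflTransGen {α β : Type*} [PseudoMetricSpace β] (g : α → β) {δ : ℝ}
    (hδ : 0 ≤ δ) {s : Finset α} {a b : α}
    (h : Relation.ReflTransGen (fun x y => x ∈ s ∧ y ∈ s ∧ dist (g x) (g y) ≤ δ) a b) :
    dist (g a) (g b) ≤ s.card * δ := by
  classical
  induction hn : s.card generalizing s a with
  | zero =>
    rcases h.cases_head with rfl | ⟨c, hc, -⟩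
    · simp
    · simp_all
  | succ n ih =>
    have key : a = b ∨ ∃ c, (a ∈ s ∧ c ∈ s ∧ dist (g a) (g c) ≤ δ) ∧
        Relation.ReflTransGen
          (fun x y => x ∈ s.erase a ∧ y ∈ s.erase a ∧ dist (g x) (g y) ≤ δ) c b := by
      clear ih hn
      induction h with
      | refl => exact .inl rfl
      | @tail b c _ hbc ih =>
        by_cases hc : a = c
        · exact .inl hc
        right
        by_cases hb : a = b
        · subst hb
          exact ⟨c, hbc, .refl⟩
        obtain ⟨e, he, hch⟩ := ih.resolve_left hb
        exact ⟨e, he, hch.tail ⟨Finset.mem_erase.2 ⟨Ne.symm hb, hbc.1⟩,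
          Finset.mem_erase.2 ⟨Ne.symm hc, hbc.2.1⟩, hbc.2.2⟩⟩
    rcases key with rfl | ⟨c, ⟨ha, -, hac⟩, hcb⟩
    · rw [dist_self]; positivity
    · have := ih hcb (by rw [Finset.card_erase_of_mem ha, hn, Nat.add_sub_cancel])
      calc dist (g a) (g b) ≤ dist (g a) (g c) + dist (g c) (g b) := dist_triangle _ _ _
        _ ≤ δ + n * δ := add_le_add hac this
        _ = (n + 1 : ℕ) * δ := by push_cast; ring

/-- A uniformly discrete set has a bounded number of points in any ball of a given radius,
uniformly in the center of the ball. -/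
theorem exists_card_inter_closedBall_le {E : Type*} [NormedAddCommGroup E] [ProperSpace E]
    {S : Set E} {r : ℝ} (hr : 0 < r)
    (hS : ∀ x ∈ S, ∀ y ∈ S, x ≠ y → r ≤ dist x y) (K : ℝ) :
    ∃ N : ℕ, ∀ w : E, ∃ s : Finset E, (s : Set E) = S ∩ Metric.closedBall w K ∧ s.card ≤ N := by
  classical
  obtain ⟨t, -, htf, ht⟩ :=
    (isCompact_closedBall (0 : E) K).finite_cover_balls (half_pos hr)
  have hc : ∀ z : E, ∃ c, ‖z‖ ≤ K → c ∈ t ∧ dist z c < r / 2 := by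
    intro z
    by_cases hz : ‖z‖ ≤ K
    · simpa [hz] using ht (mem_closedBall_zero_iff.2 hz)
    · simp [hz]
  choose c hc using hc
  refine ⟨htf.toFinset.card, fun w => ?_⟩
  have hmaps : Set.MapsTo (fun x => c (x - w)) (S ∩ Metric.closedBall w K) t := fun x hx =>
    (hc _ (by simpa [dist_eq_norm] using hx.2)).1
  have hinj : Set.InjOn (fun x => c (x - w)) (S ∩ Metric.closedBall w K) := by
    intro x hx y hy (hxy : c _ = c _)
    by_contra hne
    have h1 := (hc (x - w) (by simpa [dist_eq_norm] using hx.2)).2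
    have h2 := (hc (y - w) (by simpa [dist_eq_norm] using hy.2)).2
    rw [← hxy] at h2
    have h3 := dist_triangle_right (x - w) (y - w) (c (x - w))
    rw [dist_sub_right] at h3
    linarith [hS x hx.1 y hy.1 hne]
  have hfin := htf.of_injOn hmaps hinj
  refine ⟨hfin.toFinset, by simp, Finset.card_le_card_of_injOn (fun x => c (x - w)) ?_ ?_⟩
  · intro x hx; simpa using hmaps (by simpa using hx)
  · simpa using hinj

/-- Any two points of a relatively dense set are joined by a chain of bounded steps. -/
theorem reflTransGen_of_relativelyDense {E : Type*} [NormedAddCommGroup E]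
    [NormedSpace ℝ E] {M : Set E} {R : ℝ}
    (hM : ∀ y, ∃ x ∈ M, dist x y ≤ R) {a b : E} (ha : a ∈ M) (hb : b ∈ M) :
    Relation.ReflTransGen (fun x y => x ∈ M ∧ y ∈ M ∧ dist x y ≤ 2 * R + 1) a b := by
  have hR : 0 ≤ R := by obtain ⟨x, -, hx⟩ := hM 0; exact dist_nonneg.trans hx
  obtain ⟨n, hn⟩ := exists_nat_ge (dist a b)
  have key : ∀ k : ℕ, ∀ y, dist a y ≤ k → ∀ x ∈ M, dist x y ≤ R →
      Relation.ReflTransGen (fun x y => x ∈ M ∧ y ∈ M ∧ dist x y ≤ 2 * R + 1) a x := by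
    intro k
    induction k with
    | zero =>
      intro y hy x hx hxy
      refine .single ⟨ha, hx, ?_⟩
      have := dist_triangle_right a x y
      simp only [Nat.cast_zero] at hy
      linarith
    | succ k ih =>
      intro y hy x hx hxy
      obtain ⟨z, haz, hzy⟩ := exists_dist_le_le (δ := k) (ε := 1) (by positivity) (by positivity)
        (show dist a y ≤ 1 + k by push_cast at hy; linarith)
      obtain ⟨x', hx', hx'z⟩ := hM z
      refine (ih z haz x' hx' hx'z).tail ⟨hx', hx, ?_⟩
      have := dist_triangle4 x' z y x
      rw [dist_comm y x] at this
      linarith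
  exact key n b hn b hb (by simpa using hR)

/-- Hyers–Ulam stability: a map that is additive up to a bounded error is at bounded distance from an
additive map. -/
theorem exists_addMonoidHom_near {E F : Type*} [NormedAddCommGroup E] [NormedSpace ℝ E]
    [NormedAddCommGroup F] [NormedSpace ℝ F] [CompleteSpace F] {g : E → F} {C : ℝ}
    (hg : ∀ y z, ‖g (y + z) - g y - g z‖ ≤ C) : ∃ F' : E →+ F, ∀ y, ‖F' y - g y‖ ≤ C := by
  have hstep : ∀ y (n : ℕ), dist (((2 : ℝ) ^ n)⁻¹ • g ((2 : ℝ) ^ n • y))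
      (((2 : ℝ) ^ (n + 1))⁻¹ • g ((2 : ℝ) ^ (n + 1) • y)) ≤ C / 2 / 2 ^ n := by
    intro y n
    have h1 : (2 : ℝ) ^ (n + 1) • y = (2 : ℝ) ^ n • y + (2 : ℝ) ^ n • y := by
      rw [← add_smul]; ring_nf
    have h2 : ((2 : ℝ) ^ n)⁻¹ = ((2 : ℝ) ^ (n + 1))⁻¹ + ((2 : ℝ) ^ (n + 1))⁻¹ := by
      field_simp; ring
    rw [h1, dist_comm, dist_eq_norm, h2, add_smul, ← smul_add _ (g _), ← smul_sub, norm_smul,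
      ← sub_sub, norm_inv, norm_pow, Real.norm_ofNat]
    calc _ ≤ ((2 : ℝ) ^ (n + 1))⁻¹ * C := by gcongr; exact hg _ _
      _ = _ := by rw [pow_succ]; field_simp
  choose L hL using fun y => cauchySeq_tendsto_of_complete (cauchySeq_of_le_geometric_two (hstep y))
  have hadd : ∀ y z, L (y + z) = L y + L z := by
    intro y z
    have h0 : Filter.Tendsto (fun n : ℕ => ((2 : ℝ) ^ n)⁻¹ •
        (g ((2 : ℝ) ^ n • y + (2 : ℝ) ^ n • z) - g ((2 : ℝ) ^ n • y) - g ((2 : ℝ) ^ n • z)))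
        Filter.atTop (nhds 0) := by
      refine squeeze_zero_norm (a := fun n : ℕ => ((2 : ℝ) ^ n)⁻¹ * C) (fun n => ?_) ?_
      · rw [norm_smul, norm_inv, norm_pow, Real.norm_ofNat]
        gcongr; exact hg _ _
      · have := (tendsto_pow_atTop_nhds_zero_of_lt_one (r := (2 : ℝ)⁻¹) (by norm_num)
          (by norm_num)).mul_const C
        simpa using this
    have h1 := ((hL (y + z)).sub (hL y)).sub (hL z)
    have := tendsto_nhds_unique h1 (by simpa only [smul_add, smul_sub] using h0)
    rw [sub_sub] at this
    exact sub_eq_zero.1 this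
  refine ⟨AddMonoidHom.mk' L hadd, fun y => ?_⟩
  have := dist_le_of_le_geometric_two_of_tendsto₀ (hstep y) (hL y)
  rw [dist_comm, dist_eq_norm] at this
  simpa using this

/-- An additive map from a subgroup to a real vector space extends to the whole group. -/
theorem exists_addMonoidHom_extension {A V : Type*} [AddCommGroup A] [AddCommGroup V] [Module ℝ V]
    (G : AddSubgroup A) (f : G →+ V) : ∃ f' : A →+ V, ∀ x : G, f' x = f x := by
  let _ : DivisibleBy V ℤ := {
    div := fun v n => (n : ℝ)⁻¹ • v
    div_zero := by simp
    div_cancel := fun {n} v hn => by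
      rw [← Int.cast_smul_eq_zsmul ℝ, smul_inv_smul₀ (by exact_mod_cast hn)] }
  obtain ⟨h, hh⟩ := (Module.Baer.of_divisible V).extension_property_addMonoidHom G.subtype
    Subtype.val_injective f
  exact ⟨h, fun x => DFunLike.congr_fun hh x⟩

/-- If `M` is relatively dense and `M - M` has a bounded number of points in balls of a given
radius, then additive maps are bounded on the bounded parts of `(M - M) - (M - M)`: as one moves
`p` along a chain in `M`, a difference `q - p` with `q ∈ M` can be kept near a fixed vector, hence
takes only boundedly many values. -/
theorem exists_forall_norm_sub_le {E F : Type*} [NormedAddCommGroup E] [NormedSpace ℝ E]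
    [NormedAddCommGroup F] {M : Set E} {R : ℝ}
    (hM : ∀ y, ∃ x ∈ M, dist x y ≤ R)
    (hV : ∀ K, ∃ N : ℕ, ∀ w : E, ∃ s : Finset E,
      (s : Set E) = (M - M) ∩ Metric.closedBall w K ∧ s.card ≤ N) (f : E →+ F) (K : ℝ) :
    ∃ C, ∀ u ∈ M - M, ∀ v ∈ M - M, dist u v ≤ K → ‖f (u - v)‖ ≤ C := by
  have hR : 0 ≤ R := by obtain ⟨x, -, hx⟩ := hM 0; exact dist_nonneg.trans hx
  wlog hKR : R ≤ K generalizing K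
  · obtain ⟨C, hC⟩ := this (max K R) (le_max_right _ _)
    exact ⟨C, fun u hu v hv h => hC u hu v hv (h.trans (le_max_left _ _))⟩
  obtain ⟨δ, hδ0, hδ⟩ : ∃ δ, 0 ≤ δ ∧ ∀ u ∈ M - M, ‖u‖ ≤ 2 * R + 1 + 2 * K → ‖f u‖ ≤ δ := by
    obtain ⟨_, hN⟩ := hV (2 * R + 1 + 2 * K)
    obtain ⟨s, hs, -⟩ := hN 0
    refine ⟨∑ u ∈ s, ‖f u‖, by positivity, fun u hu hu' => ?_⟩
    refine Finset.single_le_sum (f := fun u => ‖f u‖) (fun _ _ => norm_nonneg _) ?_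
    rw [← Finset.mem_coe, hs]
    exact ⟨hu, by simpa using hu'⟩
  obtain ⟨N, hN⟩ := hV K
  refine ⟨N * (δ + δ), ?_⟩
  rintro _ ⟨x, hx, y, hy, rfl⟩ _ ⟨x', hx', y', hy', rfl⟩ hd
  simp only at hd ⊢
  obtain ⟨s, hs, hsN⟩ := hN (x - y)
  have hmem : ∀ {p q}, p ∈ M → q ∈ M → dist (q - p) (x - y) ≤ K → q - p ∈ s := by
    intro p q hp hq h
    rw [← Finset.mem_coe, hs]
    exact ⟨Set.sub_mem_sub hq hp, h⟩
  have hnear : ∀ {p p' q q'}, p ∈ M → p' ∈ M → q ∈ M → q' ∈ M → dist p p' ≤ 2 * R + 1 →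
      dist (q - p) (x - y) ≤ K → dist (q' - p') (x - y) ≤ K →
      dist (f (q - p)) (f (q' - p')) ≤ δ + δ := by
    intro p p' q q' hp hp' hq hq' hpp h h'
    have h1 : ‖f (p - p')‖ ≤ δ := hδ _ (Set.sub_mem_sub hp hp') <| by
      rw [← dist_eq_norm]; linarith
    have h2 : ‖f (q - q')‖ ≤ δ := hδ _ (Set.sub_mem_sub hq hq') <| by
      have e : q - q' = ((q - p) - (q' - p')) + (p - p') := by abel
      have h3 := dist_triangle_right (q - p) (q' - p') (x - y)
      rw [e]
      refine (norm_add_le _ _).trans ?_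
      rw [← dist_eq_norm, ← dist_eq_norm]
      linarith
    rw [dist_eq_norm, ← map_sub, show q - p - (q' - p') = (q - q') - (p - p') by abel, map_sub]
    exact (norm_sub_le _ _).trans (add_le_add h2 h1)
  have hlift : ∀ p, Relation.ReflTransGen
      (fun x y => x ∈ M ∧ y ∈ M ∧ dist x y ≤ 2 * R + 1) y p →
      ∃ q ∈ M, dist (q - p) (x - y) ≤ K ∧ Relation.ReflTransGen
        (fun u v => u ∈ s ∧ v ∈ s ∧ dist (f u) (f v) ≤ δ + δ) (x - y) (q - p) := by
    intro p hp
    induction hp with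
    | refl => exact ⟨x, hx, by simpa using hR.trans hKR, .refl⟩
    | @tail p p' _ hpp ih =>
      obtain ⟨q, hq, hqp, hch⟩ := ih
      obtain ⟨q', hq', hqp'⟩ := hM (p' + (x - y))
      have hd' : dist (q' - p') (x - y) ≤ K := by
        rw [dist_eq_norm] at hqp' ⊢
        rw [sub_sub]
        exact hqp'.trans hKR
      exact ⟨q', hq', hd', hch.tail ⟨hmem hpp.1 hq hqp, hmem hpp.2.1 hq' hd',
        hnear hpp.1 hpp.2.1 hq hq' hpp.2.2 hqp hd'⟩⟩
  obtain ⟨q, hq, hqy, hch⟩ := hlift y' (reflTransGen_of_relativelyDense hM hy hy')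
  rw [dist_comm] at hd
  have hch' := hch.tail ⟨hmem hy' hq hqy, hmem hy' hx' hd,
    hnear hy' hy' hq hx' (by rw [dist_self]; linarith) hqy hd⟩
  rw [map_sub, ← dist_eq_norm]
  refine (dist_le_card_mul_of_reflTransGen f (by positivity) hch').trans ?_
  gcongr

/-- Under the hypotheses of `exists_forall_norm_sub_le`, an additive map is at bounded distance
on `M` from a linear map. -/
theorem exists_linearMap_near {E F : Type*} [NormedAddCommGroup E] [NormedSpace ℝ E]
    [NormedAddCommGroup F] [NormedSpace ℝ F] [CompleteSpace F] {M : Set E} {R : ℝ}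
    (hM : ∀ y, ∃ x ∈ M, dist x y ≤ R)
    (hV : ∀ K, ∃ N : ℕ, ∀ w : E, ∃ s : Finset E,
      (s : Set E) = (M - M) ∩ Metric.closedBall w K ∧ s.card ≤ N) (f : E →+ F) :
    ∃ L : E →ₗ[ℝ] F, ∃ C, ∀ x ∈ M, ‖L x - f x‖ ≤ C := by
  choose ξ hξM hξ using hM
  have hM : ∀ y, ∃ x ∈ M, dist x y ≤ R := fun y => ⟨ξ y, hξM y, hξ y⟩
  have hR : 0 ≤ R := dist_nonneg.trans (hξ 0)
  have hξ0 : ‖ξ 0‖ ≤ R := by simpa using hξ 0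
  obtain ⟨C, hC⟩ := exists_forall_norm_sub_le hM hV f (4 * R + 1)
  have hC' : ∀ x ∈ M, ∀ y ∈ M, dist x y ≤ 4 * R + 1 → ‖f x - f y‖ ≤ C := by
    intro x hx y hy h
    have := hC (x - y) (Set.sub_mem_sub hx hy) (y - y) (Set.sub_mem_sub hy hy)
      (by rwa [dist_sub_right])
    rwa [sub_self, sub_zero, map_sub] at this
  have hg : ∀ y z, ‖f (ξ (y + z)) - f (ξ y) - f (ξ z)‖ ≤ C + ‖f (ξ 0)‖ := by
    intro y z
    have h := hC (ξ (y + z) - ξ y) (Set.sub_mem_sub (hξM _) (hξM _)) (ξ z - ξ 0)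
      (Set.sub_mem_sub (hξM _) (hξM _)) <| by
        have h1 := hξ (y + z)
        have h2 := hξ y
        have h3 := hξ z
        rw [dist_eq_norm] at h1 h2 h3 ⊢
        have e : ξ (y + z) - ξ y - (ξ z - ξ 0) =
          (ξ (y + z) - (y + z)) - (ξ y - y) - (ξ z - z) + ξ 0 := by abel
        rw [e]
        have h4 := norm_add_le ((ξ (y + z) - (y + z)) - (ξ y - y) - (ξ z - z)) (ξ 0)
        have h5 := norm_sub_le ((ξ (y + z) - (y + z)) - (ξ y - y)) (ξ z - z)
        have h6 := norm_sub_le (ξ (y + z) - (y + z)) (ξ y - y)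
        linarith
    have e : f (ξ (y + z)) - f (ξ y) - f (ξ z) =
        f (ξ (y + z) - ξ y - (ξ z - ξ 0)) - f (ξ 0) := by
      simp only [map_sub]; abel
    rw [e]
    exact (norm_sub_le _ _).trans (add_le_add_left h _)
  obtain ⟨L, hL⟩ := exists_addMonoidHom_near (g := fun y => f (ξ y)) hg
  have hcont : Continuous L := by
    refine L.continuous_of_isBounded_nhds_zero (Metric.closedBall_mem_nhds 0 one_pos) ?_
    refine isBounded_iff_forall_norm_le.2 ⟨(C + ‖f (ξ 0)‖) + (C + ‖f (ξ 0)‖), ?_⟩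
    rintro _ ⟨y, hy, rfl⟩
    have h1 := hC' (ξ y) (hξM y) (ξ 0) (hξM 0) <| by
      have h2 := dist_triangle4 (ξ y) y 0 (ξ 0)
      have h3 := hξ y
      have h4 : dist y 0 ≤ 1 := hy
      rw [dist_comm 0] at h2
      linarith [hξ 0]
    have e : L y = (L y - f (ξ y)) + ((f (ξ y) - f (ξ 0)) + f (ξ 0)) := by abel
    rw [e]
    exact norm_add_le_of_le (hL y) (norm_add_le_of_le h1 le_rfl)
  refine ⟨(L.toRealLinearMap hcont : E →ₗ[ℝ] F), (C + ‖f (ξ 0)‖) + C, fun x hx => ?_⟩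
  have h1 := hC' (ξ x) (hξM x) x hx (by linarith [hξ x])
  have e : L x - f x = (L x - f (ξ x)) + (f (ξ x) - f x) := by abel
  change ‖L x - f x‖ ≤ _
  rw [e]
  exact norm_add_le_of_le (hL x) h1

/-- A relatively dense set with locally finite difference set generates a finitely generated
subgroup. -/
theorem addSubgroup_closure_fg {E : Type*} [NormedAddCommGroup E]
    [NormedSpace ℝ E] {M : Set E} {R : ℝ} (hM : ∀ y, ∃ x ∈ M, dist x y ≤ R)
    (hV : ∀ K, ((M - M) ∩ Metric.closedBall 0 K).Finite) : (AddSubgroup.closure M).FG := by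
  obtain ⟨x₀, hx₀, -⟩ := hM 0
  refine (AddSubgroup.fg_iff _).2 ⟨insert x₀ ((M - M) ∩ Metric.closedBall 0 (2 * R + 1)),
    le_antisymm ?_ ?_, (hV _).insert _⟩
  · rw [AddSubgroup.closure_le]
    rintro x (rfl | ⟨⟨y, hy, z, hz, rfl⟩, -⟩)
    · exact AddSubgroup.subset_closure hx₀
    · exact sub_mem (AddSubgroup.subset_closure hy) (AddSubgroup.subset_closure hz)
  · rw [AddSubgroup.closure_le]
    intro x hx
    induction reflTransGen_of_relativelyDense hM hx₀ hx with
    | refl => exact AddSubgroup.subset_closure (Set.mem_insert _ _)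
    | @tail b c _ hbc ih =>
      rw [← sub_add_cancel c b]
      refine add_mem (AddSubgroup.subset_closure (Set.mem_insert_of_mem _
        ⟨Set.sub_mem_sub hbc.2.1 hbc.1, ?_⟩)) (ih hbc.1)
      rw [mem_closedBall_zero_iff, ← dist_eq_norm, dist_comm]
      exact hbc.2.2

/-- If `M` generates a finitely generated group and has the linear approximation property, then
`(M - M) - (M - M)` is locally finite. -/
theorem finite_sub_sub_inter_closedBall {E : Type*} [NormedAddCommGroup E] [NormedSpace ℝ E]
    [FiniteDimensional ℝ E] {M : Set E}
    (hfg : (AddSubgroup.closure M).FG)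
    (hL : ∀ (m : ℕ) (f : AddSubgroup.closure M →+ EuclideanSpace ℝ (Fin m)),
      ∃ L : E →ₗ[ℝ] EuclideanSpace ℝ (Fin m), ∃ C : ℝ, ∀ (x : E) (hx : x ∈ M),
        ‖L x - f ⟨x, AddSubgroup.subset_closure hx⟩‖ ≤ C) (K : ℝ) :
    (((M - M) - (M - M)) ∩ Metric.closedBall 0 K).Finite := by
  have : Module.Finite ℤ (AddSubgroup.closure M) :=
    Module.Finite.iff_addGroup_fg.2 ((AddGroup.fg_iff_addSubgroup_fg _).2 hfg)
  have : Module.IsTorsionFree ℤ E := .trans ℝ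
  have : Module.IsTorsionFree ℤ (AddSubgroup.closure M) :=
    Function.Injective.moduleIsTorsionFree _ Subtype.val_injective fun _ _ => rfl
  let b := Module.finBasis ℤ (AddSubgroup.closure M)
  let f : AddSubgroup.closure M →+
      EuclideanSpace ℝ (Fin (Module.finrank ℤ (AddSubgroup.closure M))) :=
    { toFun := fun x => WithLp.toLp 2 fun i => (b.repr x i : ℝ)
      map_zero' := by ext; simp
      map_add' := fun x y => by ext; simp }
  obtain ⟨L, C, hC⟩ := hL _ f
  set L' := LinearMap.toContinuousLinearMap L
  have hbd : ∀ z : AddSubgroup.closure M, (z : E) ∈ (M - M) - (M - M) →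
      ‖L z - f z‖ ≤ (C + C) + (C + C) := by
    rintro ⟨_, hz⟩ ⟨_, ⟨x, hx, y, hy, rfl⟩, _, ⟨x', hx', y', hy', rfl⟩, rfl⟩
    have e : (⟨_, hz⟩ : AddSubgroup.closure M) =
      (⟨x, AddSubgroup.subset_closure hx⟩ - ⟨y, AddSubgroup.subset_closure hy⟩) -
      (⟨x', AddSubgroup.subset_closure hx'⟩ - ⟨y', AddSubgroup.subset_closure hy'⟩) := rfl
    rw [e]
    simp only [map_sub, AddSubgroup.coe_sub]
    rw [sub_sub_sub_comm, sub_sub_sub_comm (L x), sub_sub_sub_comm (L x')]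
    exact norm_sub_le_of_le (norm_sub_le_of_le (hC x hx) (hC y hy))
      (norm_sub_le_of_le (hC x' hx') (hC y' hy'))
  set B : ℤ := ⌈(C + C) + (C + C) + ‖L'‖ * K⌉
  have hfin : {z : AddSubgroup.closure M | ∀ i, |b.repr z i| ≤ B}.Finite := by
    refine Set.Finite.of_injOn (f := fun z => (b.repr z : Fin _ → ℤ))
      (t := Set.Icc (fun _ => -B) (fun _ => B)) ?_ ?_ (Set.finite_Icc _ _)
    · exact fun z hz => ⟨fun i => (abs_le.1 (hz i)).1, fun i => (abs_le.1 (hz i)).2⟩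
    · exact (DFunLike.coe_injective.comp b.repr.injective).injOn
  refine (hfin.image Subtype.val).subset ?_
  rintro z ⟨hz, hzK⟩
  have hzG : z ∈ AddSubgroup.closure M := by
    obtain ⟨_, ⟨x, hx, y, hy, rfl⟩, _, ⟨x', hx', y', hy', rfl⟩, rfl⟩ := hz
    have := @AddSubgroup.subset_closure _ _ M
    exact sub_mem (sub_mem (this hx) (this hy)) (sub_mem (this hx') (this hy'))
  refine ⟨⟨z, hzG⟩, fun i => ?_, rfl⟩
  have h1 := hbd ⟨z, hzG⟩ hz
  have h2 : ‖L z‖ ≤ ‖L'‖ * K := (L'.le_opNorm z).trans <| by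
    gcongr; simpa using hzK
  have h3 : ‖f ⟨z, hzG⟩‖ ≤ (C + C) + (C + C) + ‖L'‖ * K := by
    have := norm_sub_norm_le (f ⟨z, hzG⟩) (L z)
    rw [norm_sub_rev] at this
    simp only at h1
    linarith
  have h4 := (PiLp.norm_apply_le (f ⟨z, hzG⟩) i).trans (h3.trans (Int.le_ceil _))
  have h5 : (f ⟨z, hzG⟩) i = (b.repr ⟨z, hzG⟩ i : ℝ) := rfl
  rw [h5, Real.norm_eq_abs] at h4
  exact_mod_cast h4

/-- A relatively dense set `M ⊆ ℝ^d` is Meyer iff the group `[M]` it generates is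
finitely generated and `M` has the linear approximation property. -/
theorem meyer_iff_fg_and_linear_approximation {d : ℕ}
    (M : Set (EuclideanSpace ℝ (Fin d))) (hM : RelativelyDense M) :
    IsMeyer M ↔
      (AddSubgroup.closure M).FG ∧
        ∀ (m : ℕ) (f : (AddSubgroup.closure M) →+ EuclideanSpace ℝ (Fin m)),
          ∃ F : EuclideanSpace ℝ (Fin d) →ₗ[ℝ] EuclideanSpace ℝ (Fin m), ∃ C : ℝ,
            ∀ (x : EuclideanSpace ℝ (Fin d)) (hx : x ∈ M),
              ‖F x - f ⟨x, AddSubgroup.subset_closure hx⟩‖ ≤ C := by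
  constructor
  · rintro ⟨⟨R, -, hR⟩, r, hr, hV⟩
    have hN := exists_card_inter_closedBall_le hr hV
    refine ⟨addSubgroup_closure_fg hR fun K => ?_, fun m f => ?_⟩
    · obtain ⟨_, hs⟩ := hN K
      obtain ⟨s, hs, -⟩ := hs 0
      exact hs ▸ s.finite_toSet
    · obtain ⟨f', hf'⟩ := exists_addMonoidHom_extension _ f
      obtain ⟨L, C, hL⟩ := exists_linearMap_near hR hN f'
      exact ⟨L, C, fun x hx => by simpa only [← hf'] using hL x hx⟩
  · rintro ⟨hfg, hL⟩
    have hfin := (finite_sub_sub_inter_closedBall hfg hL 1).subset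
      (Set.sdiff_subset (t := {0}))
    obtain ⟨ε, hε, hball⟩ := Metric.mem_nhds_iff.1
      (hfin.isClosed.isOpen_compl.mem_nhds (x := 0) (by simp))
    refine ⟨hM, min ε 1, by positivity, fun u hu v hv huv => ?_⟩
    by_contra! h
    have hmem : u - v ∈ Metric.ball 0 ε := by
      rw [mem_ball_zero_iff, ← dist_eq_norm]
      exact h.trans_le (min_le_left _ _)
    refine hball hmem ⟨⟨Set.sub_mem_sub hu hv, ?_⟩, sub_ne_zero.2 huv⟩
    rw [mem_closedBall_zero_iff, ← dist_eq_norm]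
    exact h.le.trans (min_le_right _ _)
end

section
/- Let M ⊆ ℝ^d be a Meyer set, let f : [M] → ℝ^d be an additive group homomorphism, and assume that the image f(M) is untied, i.e., there is no (d−1)-dimensional linear subspace H ⊆ ℝ^d and no r > 0 with f(M) ⊆ H + B_r (where B_r is the closed ball of radius r about 0). Then f(M) is a Meyer set in ℝ^d. -/
open scoped Pointwise

/-- `S` is tied if it lies within bounded distance of a `(d-1)`-dimensional
linear subspace of `ℝ^d`. -/
def Tied {d : ℕ} (S : Set (EuclideanSpace ℝ (Fin d))) : Prop :=
  ∃ H : Submodule ℝ (EuclideanSpace ℝ (Fin d)), Module.finrank ℝ H = d - 1 ∧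
    ∃ r > (0 : ℝ), S ⊆ (H : Set (EuclideanSpace ℝ (Fin d))) + Metric.closedBall 0 r

/-- The image of the part of `T` lying in `[M]` under a homomorphism defined on `[M]`. -/
def homImage {d m : ℕ} {M : Set (EuclideanSpace ℝ (Fin d))}
    (f : (AddSubgroup.closure M) →+ EuclideanSpace ℝ (Fin m))
    (T : Set (EuclideanSpace ℝ (Fin d))) : Set (EuclideanSpace ℝ (Fin m)) :=
  f '' {x : AddSubgroup.closure M | (x : EuclideanSpace ℝ (Fin d)) ∈ T}

open Filter Topology

/-- In a set with at most `k` points, a path all of whose steps lie in a finite set `G` has its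
total displacement in a finite set that depends on `G` and `k` only. -/
lemma exists_finite_displacements {E : Type*} [AddCommGroup E] {G : Set E} (hG : G.Finite)
    (k : ℕ) : ∃ F : Set E, F.Finite ∧ ∀ T : Set E, T.encard ≤ k → ∀ (n : ℕ) (w : ℕ → E),
      (∀ i ≤ n, w i ∈ T) → (∀ i < n, w (i + 1) - w i ∈ G) → w n - w 0 ∈ F := by
  classical
  induction k with
  | zero =>
    refine ⟨∅, Set.finite_empty, fun T hT n w hw _ => ?_⟩
    have hT0 : T = ∅ := by simpa using hT
    simpa [hT0] using hw 0 (Nat.zero_le n)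
  | succ k ih =>
    obtain ⟨F, hF, hFT⟩ := ih
    refine ⟨{0} ∪ (G + F), (Set.finite_singleton 0).union (hG.add hF),
      fun T hT n w hw hstep => ?_⟩
    set j := Nat.findGreatest (fun j => w j = w 0) n with hj
    have hjn : j ≤ n := Nat.findGreatest_le n
    have hwj : w j = w 0 :=
      Nat.findGreatest_spec (P := fun j => w j = w 0) (Nat.zero_le n) rfl
    rcases hjn.eq_or_lt with h | h
    · left
      rw [← h, hwj]
      simp
    · right
      have hT' : (T \ {w 0}).encard ≤ k := by
        have h1 := Set.encard_sdiff_singleton_add_one (hw 0 (Nat.zero_le n))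
        rw [← h1] at hT
        push_cast at hT
        exact (ENat.add_le_add_iff_right ENat.one_ne_top).mp hT
      have hmem := hFT _ hT' (n - (j + 1)) (fun i => w (j + 1 + i))
        (fun i hi => ⟨hw _ (by omega),
          Nat.findGreatest_is_greatest (P := fun j => w j = w 0) (n := n)
            (show j < j + 1 + i by omega) (by omega)⟩)
        (fun i hi => hstep (j + 1 + i) (by omega))
      refine Set.mem_add.mpr ⟨_, hstep j h, _, hmem, ?_⟩
      simp only [add_zero, Nat.add_sub_cancel' (Nat.succ_le_of_lt h), hwj]
      abel

/-- The number of points of a uniformly discrete set in a ball is bounded uniformly in the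
centre of the ball. -/
lemma UniformlyDiscrete.exists_encard_inter_closedBall_le {d : ℕ}
    {S : Set (EuclideanSpace ℝ (Fin d))} (hS : UniformlyDiscrete S) (C : ℝ) :
    ∃ k : ℕ, ∀ c, (S ∩ Metric.closedBall c C).encard ≤ k := by
  obtain ⟨r, hr, hS⟩ := hS
  obtain ⟨t, -, ht, hcov⟩ :=
    (isCompact_closedBall (0 : EuclideanSpace ℝ (Fin d)) C).finite_cover_balls (half_pos hr)
  refine ⟨t.ncard, fun c => ?_⟩
  rw [ht.cast_ncard_eq]
  have hex : ∀ x : EuclideanSpace ℝ (Fin d), ∃ y, x ∈ S ∩ Metric.closedBall c C →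
      y ∈ t ∧ dist (x - c) y < r / 2 := by
    intro x
    by_cases hx : x ∈ S ∩ Metric.closedBall c C
    · have : x - c ∈ Metric.closedBall (0 : EuclideanSpace ℝ (Fin d)) C := by
        simpa [dist_eq_norm] using hx.2
      obtain ⟨y, hy, hxy⟩ := Set.mem_iUnion₂.mp (hcov this)
      exact ⟨y, fun _ => ⟨hy, hxy⟩⟩
    · exact ⟨0, fun h => absurd h hx⟩
  choose φ hφ using hex
  refine Set.encard_le_encard_of_injOn (f := φ) (fun x hx => (hφ x hx).1) ?_
  intro x hx y hy hxy
  by_contra hne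
  have h1 := hS x hx.1 y hy.1 hne
  have h2 := (hφ x hx).2
  have h3 := (hφ y hy).2
  rw [← hxy] at h3
  have h4 := dist_triangle_right (x - c) (y - c) (φ x)
  rw [dist_sub_right] at h4
  linarith

lemma UniformlyDiscrete.finite_inter_closedBall {d : ℕ}
    {S : Set (EuclideanSpace ℝ (Fin d))} (hS : UniformlyDiscrete S)
    (c : EuclideanSpace ℝ (Fin d)) (C : ℝ) : (S ∩ Metric.closedBall c C).Finite := by
  obtain ⟨k, hk⟩ := hS.exists_encard_inter_closedBall_le C
  exact Set.finite_of_encard_le_coe (hk c)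

/-- A sequence can be shadowed by points of a relatively dense set, with prescribed endpoints. -/
lemma exists_shadowing_path {E : Type*} [NormedAddCommGroup E] {M : Set E} {R S : ℝ}
    (hM : ∀ y : E, ∃ x ∈ M, dist x y ≤ R) (hRS : R ≤ S) (l : ℕ → E) {n : ℕ} (hn : n ≠ 0)
    {a b : E} (ha : a ∈ M) (hb : b ∈ M) (hal : ‖a - l 0‖ ≤ S) (hbl : ‖b - l n‖ ≤ S) :
    ∃ p : ℕ → E, p 0 = a ∧ p n = b ∧ ∀ i, p i ∈ M ∧ ‖p i - l i‖ ≤ S := by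
  choose g hgM hg using hM
  refine ⟨fun i => if i = 0 then a else if i = n then b else g (l i), by simp, by simp [hn],
    fun i => ?_⟩
  dsimp only
  split_ifs with h0 h1
  · exact ⟨ha, h0 ▸ hal⟩
  · exact ⟨hb, h1 ▸ hbl⟩
  · exact ⟨hgM _, by simpa [dist_eq_norm] using (hg (l i)).trans hRS⟩

/-- If `M` is a Meyer set, then `(M - M) - (M - M)` is locally finite. -/
lemma IsMeyer.finite_sub_sub_inter_closedBall {d : ℕ} {M : Set (EuclideanSpace ℝ (Fin d))}
    (hM : IsMeyer M) {C : ℝ} (hC : 0 ≤ C) :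
    (((M - M) - (M - M)) ∩ Metric.closedBall 0 C).Finite := by
  obtain ⟨⟨R, hR, hdense⟩, hdisc⟩ := hM
  obtain ⟨k, hk⟩ := hdisc.exists_encard_inter_closedBall_le (2 * R + C)
  set D := M - M
  have hG := (hdisc.finite_inter_closedBall 0 (2 * R + 1)).sub
    (hdisc.finite_inter_closedBall 0 (2 * (R + C) + 1))
  obtain ⟨F, hF, hFT⟩ := exists_finite_displacements hG k
  refine hF.subset ?_
  rintro _ ⟨⟨_, ⟨x, hx, y, hy, rfl⟩, _, ⟨x', hx', y', hy', rfl⟩, rfl⟩, hz⟩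
  simp only [mem_closedBall_zero_iff] at hz
  set n := ⌈‖x - y‖⌉₊ + 1 with hn
  have hn0 : n ≠ 0 := by omega
  have hnpos : (0 : ℝ) < n := by positivity
  let l : ℕ → EuclideanSpace ℝ (Fin d) := fun i => y + ((i : ℝ) / n) • (x - y)
  have hl : ∀ i, ‖l (i + 1) - l i‖ ≤ 1 := by
    intro i
    have h1 : l (i + 1) - l i = (1 / (n : ℝ)) • (x - y) := by
      simp only [l]
      rw [add_sub_add_left_eq_sub, ← sub_smul]
      congr 1
      push_cast
      ring
    rw [h1, norm_smul, Real.norm_of_nonneg (by positivity), one_div_mul_eq_div, div_le_one hnpos]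
    have h2 := Nat.le_ceil ‖x - y‖
    rw [hn]
    push_cast
    linarith
  have hl0 : l 0 = y := by simp [l]
  have hln : l n = x := by simp [l, hnpos.ne']
  obtain ⟨p, hp0, hpn, hp⟩ := exists_shadowing_path hdense le_rfl l hn0 hy hx
    (by simp [hl0, hR.le]) (by simp [hln, hR.le])
  obtain ⟨q, hq0, hqn, hq⟩ := exists_shadowing_path hdense (le_add_of_nonneg_right hC)
    (fun i => l i + (y' - y)) hn0 hy' hx' (by simp [hl0]; positivity) (by
      have h1 : x' - (l n + (y' - y)) = -(x - y - (x' - y')) := by rw [hln]; abel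
      rw [h1, norm_neg]
      linarith)
  have hmem := hFT _ (hk (y - y')) n (fun i => p i - q i) (fun i _ => ?_) (fun i _ => ?_)
  · simp only [hp0, hpn, hq0, hqn] at hmem
    rw [sub_sub_sub_comm] at hmem
    exact hmem
  · refine ⟨Set.sub_mem_sub (hp i).1 (hq i).1, ?_⟩
    rw [mem_closedBall_iff_norm]
    have h1 : p i - q i - (y - y') = (p i - l i) - (q i - (l i + (y' - y))) := by abel
    rw [h1]
    linarith [norm_sub_le (p i - l i) (q i - (l i + (y' - y))), (hp i).2, (hq i).2]
  · have h1 : p (i + 1) - q (i + 1) - (p i - q i) = (p (i + 1) - p i) - (q (i + 1) - q i) := by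
      abel
    rw [h1]
    have key : ∀ (S : ℝ) (w m : ℕ → EuclideanSpace ℝ (Fin d)), (∀ i, ‖w i - m i‖ ≤ S) →
        ‖m (i + 1) - m i‖ ≤ 1 → ‖w (i + 1) - w i‖ ≤ 2 * S + 1 := by
      intro S w m hw hm
      have h2 : w (i + 1) - w i = (w (i + 1) - m (i + 1)) + (m (i + 1) - m i) - (w i - m i) := by
        abel
      rw [h2]
      linarith [norm_sub_le ((w (i + 1) - m (i + 1)) + (m (i + 1) - m i)) (w i - m i),
        norm_add_le (w (i + 1) - m (i + 1)) (m (i + 1) - m i), hw i, hw (i + 1)]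
    refine Set.sub_mem_sub ⟨Set.sub_mem_sub (hp _).1 (hp _).1, ?_⟩
      ⟨Set.sub_mem_sub (hq _).1 (hq _).1, ?_⟩
    · rw [mem_closedBall_zero_iff]
      exact key R p l (fun i => (hp i).2) (hl i)
    · rw [mem_closedBall_zero_iff]
      exact key (R + C) q _ (fun i => (hq i).2) (by simpa using hl i)

/-- Hyers' theorem: an approximately additive map between real normed spaces that is bounded on
the unit ball is at bounded distance from a continuous linear map. -/
lemma exists_continuousLinearMap_of_approx_additive {E F : Type*} [NormedAddCommGroup E]
    [NormedSpace ℝ E] [NormedAddCommGroup F] [NormedSpace ℝ F] [CompleteSpace F] {h : E → F}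
    {C B : ℝ} (hadd : ∀ u v, ‖h (u + v) - h u - h v‖ ≤ C) (hB : ∀ v, ‖v‖ ≤ 1 → ‖h v‖ ≤ B) :
    ∃ L : E →L[ℝ] F, ∀ v, ‖h v - L v‖ ≤ C := by
  let a : E → ℕ → F := fun v n => ((2 : ℝ) ^ n)⁻¹ • h ((2 : ℝ) ^ n • v)
  have hstep : ∀ v n, dist (a v n) (a v (n + 1)) ≤ C / 2 / 2 ^ n := by
    intro v n
    have h1 := hadd ((2 : ℝ) ^ n • v) ((2 : ℝ) ^ n • v)
    have h2 : (2 : ℝ) ^ n • v + (2 : ℝ) ^ n • v = (2 : ℝ) ^ (n + 1) • v := by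
      rw [← two_smul ℝ, smul_smul, pow_succ']
    rw [h2] at h1
    have h3 : a v (n + 1) - a v n = ((2 : ℝ) ^ (n + 1))⁻¹ •
        (h ((2 : ℝ) ^ (n + 1) • v) - h ((2 : ℝ) ^ n • v) - h ((2 : ℝ) ^ n • v)) := by
      have h4 : ((2 : ℝ) ^ n)⁻¹ = ((2 : ℝ) ^ (n + 1))⁻¹ * 2 := by
        field_simp
        ring
      simp only [a]
      rw [h4, mul_smul, two_smul, smul_sub, smul_sub, smul_add]
      abel
    rw [dist_comm, dist_eq_norm, h3, norm_smul, Real.norm_of_nonneg (by positivity)]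
    calc ((2 : ℝ) ^ (n + 1))⁻¹ * _ ≤ ((2 : ℝ) ^ (n + 1))⁻¹ * C := by gcongr
      _ = C / 2 / 2 ^ n := by field_simp; ring
  have hlim : ∀ v, ∃ x, Tendsto (a v) atTop (𝓝 x) := fun v =>
    cauchySeq_tendsto_of_complete (cauchySeq_of_le_geometric_two (hstep v))
  choose L hL using hlim
  have hLh : ∀ v, ‖h v - L v‖ ≤ C := by
    intro v
    have h1 := dist_le_of_le_geometric_two_of_tendsto₀ (hstep v) (hL v)
    simpa [a, dist_eq_norm] using h1
  have hLadd : ∀ u v, L (u + v) = L u + L v := by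
    intro u v
    have h1 : Tendsto (fun n => a (u + v) n - a u n - a v n) atTop
        (𝓝 (L (u + v) - L u - L v)) := ((hL (u + v)).sub (hL u)).sub (hL v)
    have h2 : Tendsto (fun n => a (u + v) n - a u n - a v n) atTop (𝓝 0) := by
      refine squeeze_zero_norm (a := fun n : ℕ => C * (1 / 2 : ℝ) ^ n) (fun n => ?_) ?_
      · simp only [a]
        rw [← smul_sub, ← smul_sub, norm_smul, Real.norm_of_nonneg (by positivity), smul_add,
          mul_comm, one_div, inv_pow]
        gcongr
        exact hadd _ _
      · simpa using (tendsto_pow_atTop_nhds_zero_of_lt_one (by norm_num : (0 : ℝ) ≤ 1 / 2)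
          (by norm_num)).const_mul C
    have h3 := tendsto_nhds_unique h1 h2
    rwa [sub_sub, sub_eq_zero] at h3
  let L' : E →+ F := AddMonoidHom.mk' L hLadd
  have hcont : Continuous L' := by
    refine L'.continuous_of_isBounded_nhds_zero (Metric.closedBall_mem_nhds 0 one_pos) ?_
    refine isBounded_iff_forall_norm_le.mpr ⟨B + C, ?_⟩
    rintro _ ⟨v, hv, rfl⟩
    have h1 := norm_sub_le (h v) (h v - L v)
    rw [sub_sub_cancel] at h1
    exact h1.trans (add_le_add (hB v (by simpa using hv)) (hLh v))
  exact ⟨L'.toRealLinearMap hcont, hLh⟩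

/-- A homomorphism on the group generated by a Meyer set is bounded on bounded parts of
`(M - M) - (M - M)`. -/
lemma IsMeyer.exists_norm_le {d : ℕ} {M : Set (EuclideanSpace ℝ (Fin d))} (hM : IsMeyer M)
    {F : Type*} [NormedAddCommGroup F] (f : AddSubgroup.closure M →+ F) {C : ℝ} (hC : 0 ≤ C) :
    ∃ K : ℝ, ∀ z : AddSubgroup.closure M,
      (z : EuclideanSpace ℝ (Fin d)) ∈ (M - M) - (M - M) →
      ‖(z : EuclideanSpace ℝ (Fin d))‖ ≤ C → ‖f z‖ ≤ K := by
  have hfin := (hM.finite_sub_sub_inter_closedBall hC).preimage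
    (f := ((↑) : AddSubgroup.closure M → EuclideanSpace ℝ (Fin d))) Subtype.val_injective.injOn
  obtain ⟨K, hK⟩ := isBounded_iff_forall_norm_le.mp (hfin.image f).isBounded
  exact ⟨K, fun z hz hzC => hK _ ⟨z, ⟨hz, by simpa using hzC⟩, rfl⟩⟩

/-- A homomorphism on the group generated by a Meyer set `M` is at bounded distance from a linear
map on `M`. -/
lemma IsMeyer.exists_linear_approx {d : ℕ} {M : Set (EuclideanSpace ℝ (Fin d))} (hM : IsMeyer M)
    {F : Type*} [NormedAddCommGroup F] [NormedSpace ℝ F] [CompleteSpace F]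
    (f : AddSubgroup.closure M →+ F) :
    ∃ (L : EuclideanSpace ℝ (Fin d) →L[ℝ] F) (C : ℝ), ∀ x : AddSubgroup.closure M,
      (x : EuclideanSpace ℝ (Fin d)) ∈ M → ‖f x - L x‖ ≤ C := by
  obtain ⟨R, hR, hdense⟩ := hM.1
  choose g' hg'M hg' using hdense
  let g : EuclideanSpace ℝ (Fin d) → AddSubgroup.closure M :=
    fun v => ⟨g' v, AddSubgroup.subset_closure (hg'M v)⟩
  have hgM : ∀ v, (g v : EuclideanSpace ℝ (Fin d)) ∈ M := hg'M
  have hg : ∀ v, ‖(g v : EuclideanSpace ℝ (Fin d)) - v‖ ≤ R := fun v => by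
    simpa [dist_eq_norm] using hg' v
  let h : EuclideanSpace ℝ (Fin d) → F := fun v => f (g v - g 0)
  obtain ⟨K, hK⟩ := hM.exists_norm_le f (C := 4 * R) (by positivity)
  obtain ⟨B, hB⟩ := hM.exists_norm_le f (C := 2 * R + 1) (by positivity)
  have hadd : ∀ u v, ‖h (u + v) - h u - h v‖ ≤ K := by
    intro u v
    simp only [h]
    rw [← map_sub, ← map_sub]
    refine hK _ ?_ ?_
    · refine ⟨_, Set.sub_mem_sub (hgM (u + v)) (hgM u), _, Set.sub_mem_sub (hgM v) (hgM 0), ?_⟩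
      push_cast
      abel
    · push_cast
      have h1 : (g (u + v) : EuclideanSpace ℝ (Fin d)) - g 0 - (g u - g 0) - (g v - g 0)
          = (g (u + v) - (u + v)) - (g u - u) - ((g v - v) - (g 0 - 0)) := by abel
      rw [h1]
      linarith [norm_sub_le ((g (u + v) : EuclideanSpace ℝ (Fin d)) - (u + v) - (g u - u))
          ((g v - v) - (g 0 - 0)),
        norm_sub_le ((g (u + v) : EuclideanSpace ℝ (Fin d)) - (u + v)) (g u - u),
        norm_sub_le ((g v : EuclideanSpace ℝ (Fin d)) - v) (g 0 - 0),
        hg (u + v), hg u, hg v, hg 0]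
  have hbdd : ∀ v, ‖v‖ ≤ 1 → ‖h v‖ ≤ B := by
    intro v hv
    refine hB _ ?_ ?_
    · refine ⟨_, Set.sub_mem_sub (hgM v) (hgM 0), _, Set.sub_mem_sub (hgM 0) (hgM 0), ?_⟩
      simp
    · push_cast
      have h1 : (g v : EuclideanSpace ℝ (Fin d)) - g 0 = (g v - v) - (g 0 - 0) + v := by abel
      rw [h1]
      linarith [norm_add_le ((g v : EuclideanSpace ℝ (Fin d)) - v - (g 0 - 0)) v,
        norm_sub_le ((g v : EuclideanSpace ℝ (Fin d)) - v) (g 0 - 0), hg v, hg 0]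
  obtain ⟨L, hL⟩ := exists_continuousLinearMap_of_approx_additive hadd hbdd
  refine ⟨L, B + K + ‖f (g 0)‖, fun x hx => ?_⟩
  have h1 : ‖f (x - g x)‖ ≤ B := by
    refine hB _ ?_ ?_
    · refine ⟨_, Set.sub_mem_sub hx (hgM x), _, Set.sub_mem_sub (hgM 0) (hgM 0), ?_⟩
      simp
    · push_cast
      rw [norm_sub_rev]
      linarith [hg x]
  have h2 : f x - L x = f (x - g x) + (h x - L x) + f (g 0) := by
    simp only [h, map_sub]
    abel
  rw [h2]
  exact norm_add₃_le.trans (add_le_add_left (add_le_add h1 (hL x)) _)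

/-- A set within bounded distance of a proper subspace is tied. -/
lemma tied_of_subset_add_closedBall {d : ℕ} {S : Set (EuclideanSpace ℝ (Fin d))}
    {V : Submodule ℝ (EuclideanSpace ℝ (Fin d))} (hV : V ≠ ⊤) {C : ℝ}
    (hS : ∀ s ∈ S, ∃ v ∈ V, ‖s - v‖ ≤ C) : Tied S := by
  obtain ⟨φ, hφ, hker⟩ := V.exists_le_ker_of_lt_top hV.lt_top
  refine ⟨LinearMap.ker φ, ?_, max C 1, by positivity, fun s hs => ?_⟩
  · have h1 := Module.Dual.finrank_ker_add_one_of_ne_zero hφ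
    rw [finrank_euclideanSpace_fin] at h1
    omega
  · obtain ⟨v, hv, hsv⟩ := hS s hs
    exact ⟨v, hker hv, s - v, by simpa using Or.inl hsv, by simp⟩

/-- If `M` is a Meyer set and `f : [M] → ℝ^d` is a group homomorphism with `f(M)` untied,
then `f(M)` is a Meyer set. -/
theorem meyer_of_untied_deformation {d : ℕ} (M : Set (EuclideanSpace ℝ (Fin d)))
    (hM : IsMeyer M) (f : (AddSubgroup.closure M) →+ EuclideanSpace ℝ (Fin d))
    (huntied : ¬ Tied (homImage f M)) :
    IsMeyer (homImage f M) := by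
  obtain ⟨L, C, hL⟩ := hM.exists_linear_approx f
  have hsurj : LinearMap.range L.toLinearMap = ⊤ := by
    by_contra hne
    refine huntied (tied_of_subset_add_closedBall hne (C := C) ?_)
    rintro _ ⟨x, hx, rfl⟩
    exact ⟨L x, ⟨x, rfl⟩, hL x hx⟩
  let e : EuclideanSpace ℝ (Fin d) ≃L[ℝ] EuclideanSpace ℝ (Fin d) :=
    (LinearEquiv.ofBijective L.toLinearMap
      ⟨LinearMap.injective_iff_surjective.mpr (LinearMap.range_eq_top.mp hsurj),
        LinearMap.range_eq_top.mp hsurj⟩).toContinuousLinearEquiv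
  have he : ∀ x, e x = L x := fun x => rfl
  obtain ⟨R, hR, hdense⟩ := hM.1
  have hC : 0 ≤ C := by
    obtain ⟨x, hx, -⟩ := hdense 0
    exact (norm_nonneg _).trans (hL ⟨x, AddSubgroup.subset_closure hx⟩ hx)
  constructor
  · refine ⟨C + ‖L‖ * R + 1, by positivity, fun y => ?_⟩
    obtain ⟨x, hx, hxy⟩ := hdense (e.symm y)
    refine ⟨_, ⟨⟨x, AddSubgroup.subset_closure hx⟩, hx, rfl⟩, ?_⟩
    have h1 := hL ⟨x, AddSubgroup.subset_closure hx⟩ hx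
    have h2 : ‖L x - y‖ ≤ ‖L‖ * R := by
      have h3 : L x - y = L (x - e.symm y) := by
        rw [map_sub, ← he (e.symm y), e.apply_symm_apply]
      rw [h3]
      rw [dist_eq_norm] at hxy
      exact (L.le_opNorm _).trans (by gcongr)
    rw [dist_eq_norm]
    linarith [norm_sub_le_norm_sub_add_norm_sub (f ⟨x, AddSubgroup.subset_closure hx⟩) (L x) y]
  · set e' := (e.symm : EuclideanSpace ℝ (Fin d) →L[ℝ] EuclideanSpace ℝ (Fin d))
    have hfin := ((hM.finite_sub_sub_inter_closedBall
      (C := ‖e'‖ * (4 * C + 1)) (by positivity)).preimage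
      (f := ((↑) : AddSubgroup.closure M → EuclideanSpace ℝ (Fin d)))
      Subtype.val_injective.injOn).image f
    set A := f '' (((↑) : AddSubgroup.closure M → EuclideanSpace ℝ (Fin d)) ⁻¹'
      (((M - M) - (M - M)) ∩ Metric.closedBall 0 (‖e'‖ * (4 * C + 1))))
    have hgap : ∃ r > (0 : ℝ), ∀ z ∈ A, z ≠ 0 → r ≤ ‖z‖ := by
      have hopen := (hfin.subset (Set.sdiff_subset (t := {0}))).isClosed.isOpen_compl
      obtain ⟨r, hr, hball⟩ := Metric.isOpen_iff.mp hopen 0 (by simp)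
      refine ⟨r, hr, fun z hz hz0 => ?_⟩
      by_contra! hlt
      exact hball (by simpa using hlt) ⟨hz, hz0⟩
    obtain ⟨r, hr, hgap⟩ := hgap
    refine ⟨min r 1, by positivity, ?_⟩
    rintro _ ⟨_, ⟨x, hx, rfl⟩, _, ⟨y, hy, rfl⟩, rfl⟩ _
      ⟨_, ⟨x', hx', rfl⟩, _, ⟨y', hy', rfl⟩, rfl⟩ hne
    by_contra! hlt
    have hz : f x - f y - (f x' - f y') = f (x - y - (x' - y')) := by simp
    simp only [dist_eq_norm] at hlt
    have hmem : f x - f y - (f x' - f y') ∈ A := by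
      rw [hz]
      refine ⟨_, ⟨?_, ?_⟩, rfl⟩
      · push_cast
        exact Set.sub_mem_sub (Set.sub_mem_sub hx hy) (Set.sub_mem_sub hx' hy')
      · rw [mem_closedBall_zero_iff]
        push_cast
        set z : EuclideanSpace ℝ (Fin d) :=
          (x : EuclideanSpace ℝ (Fin d)) - y - (x' - y') with hzdef
        have h1 : z = e' (L z) := by
          rw [← he]
          exact (e.symm_apply_apply z).symm
        rw [h1]
        refine (e'.le_opNorm _).trans ?_
        gcongr
        have h2 : L z = (f x - f y - (f x' - f y')) - ((f x - L x) - (f y - L y))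
            + ((f x' - L x') - (f y' - L y')) := by
          simp only [hzdef, map_sub]
          abel
        rw [h2]
        have h3 := hlt.le.trans (min_le_right r 1)
        linarith [norm_add_le ((f x - f y - (f x' - f y')) - ((f x - L x) - (f y - L y)))
            ((f x' - L x') - (f y' - L y')),
          norm_sub_le (f x - f y - (f x' - f y')) ((f x - L x) - (f y - L y)),
          norm_sub_le (f x - L x) (f y - L y), norm_sub_le (f x' - L x') (f y' - L y'),
          hL x hx, hL y hy, hL x' hx', hL y' hy']
    exact absurd (hlt.trans_le (min_le_left r 1)) (not_lt.mpr (hgap _ hmem (sub_ne_zero.mpr hne)))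
end

section
/- Let M ⊆ ℝ^d be relatively dense and let f : [M] → ℝ^m be an additive group homomorphism. If F₁, F₂ : ℝ^d → ℝ^m are ℝ-linear maps such that both ‖F₁(x) − f(x)‖ and ‖F₂(x) − f(x)‖ are uniformly bounded over x ∈ M, then F₁ = F₂. -/
open scoped Pointwise

/-- A linear map that is bounded in norm on the whole space vanishes. -/
lemma LinearMap.eq_zero_of_forall_norm_le {E F : Type*} [AddCommGroup E] [Module ℝ E]
    [NormedAddCommGroup F] [NormedSpace ℝ F] (G : E →ₗ[ℝ] F) (B : ℝ)
    (hG : ∀ x, ‖G x‖ ≤ B) : G = 0 := by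
  ext x
  by_contra hx
  obtain ⟨n, hn⟩ := exists_nat_gt (B / ‖G x‖)
  have hlt : B < n * ‖G x‖ := (div_lt_iff₀ (norm_pos_iff.mpr hx)).mp hn
  have hle := hG ((n : ℝ) • x)
  rw [map_smul, norm_smul, RCLike.norm_natCast] at hle
  exact hle.not_gt hlt

/-- A linear map that is bounded in norm on a relatively dense set vanishes. -/
lemma RelativelyDense.linearMap_eq_zero {d : ℕ} {M : Set (EuclideanSpace ℝ (Fin d))}
    (hM : RelativelyDense M) {F : Type*} [NormedAddCommGroup F] [NormedSpace ℝ F]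
    (G : EuclideanSpace ℝ (Fin d) →ₗ[ℝ] F) (C : ℝ) (hG : ∀ x ∈ M, ‖G x‖ ≤ C) : G = 0 := by
  obtain ⟨R, -, hR⟩ := hM
  refine G.eq_zero_of_forall_norm_le (C + ‖G.toContinuousLinearMap‖ * R) fun y ↦ ?_
  obtain ⟨x, hx, hxy⟩ := hR y
  calc ‖G y‖ ≤ ‖G x‖ + ‖G (x - y)‖ := by
        rw [map_sub]
        exact norm_le_norm_add_norm_sub _ _
    _ ≤ C + ‖G.toContinuousLinearMap‖ * R :=
        add_le_add (hG x hx)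
          (G.toContinuousLinearMap.le_opNorm_of_le (dist_eq_norm x y ▸ hxy))

/-- The linear map associated to a homomorphism `f : [M] → ℝ^m` along a relatively
dense set `M` is unique. -/
theorem associated_linear_map_unique {d m : ℕ} (M : Set (EuclideanSpace ℝ (Fin d)))
    (hM : RelativelyDense M)
    (f : (AddSubgroup.closure M) →+ EuclideanSpace ℝ (Fin m))
    (F₁ F₂ : EuclideanSpace ℝ (Fin d) →ₗ[ℝ] EuclideanSpace ℝ (Fin m))
    (C₁ C₂ : ℝ)
    (h₁ : ∀ (x : EuclideanSpace ℝ (Fin d)) (hx : x ∈ M),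
      ‖F₁ x - f ⟨x, AddSubgroup.subset_closure hx⟩‖ ≤ C₁)
    (h₂ : ∀ (x : EuclideanSpace ℝ (Fin d)) (hx : x ∈ M),
      ‖F₂ x - f ⟨x, AddSubgroup.subset_closure hx⟩‖ ≤ C₂) :
    F₁ = F₂ := by
  rw [← sub_eq_zero]
  refine hM.linearMap_eq_zero (F₁ - F₂) (C₁ + C₂) fun x hx ↦ ?_
  rw [LinearMap.sub_apply, ← sub_sub_sub_cancel_right]
  exact (norm_sub_le _ _).trans (add_le_add (h₁ x hx) (h₂ x hx))
end

section
/- Let M ⊆ ℝ^d have finite local complexity (i.e., (M − M) ∩ K is finite for every compact K ⊆ ℝ^d), let f : [M] → ℝ^d be an additive group homomorphism, and let F : ℝ^d → ℝ^d be a linear isomorphism such that ‖F(x) − f(x)‖ is uniformly bounded over x ∈ M. Then f(M) has finite local complexity: (f(M) − f(M)) ∩ K is finite for every compact K ⊆ ℝ^d. In particular f(M) is uniformly discrete. -/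
open scoped Pointwise

/-- Finite local complexity: `(M - M) ∩ K` is finite for every compact `K`. -/
def FLC {d : ℕ} (M : Set (EuclideanSpace ℝ (Fin d))) : Prop :=
  ∀ K : Set (EuclideanSpace ℝ (Fin d)), IsCompact K → ((M - M) ∩ K).Finite

theorem FLC.uniformlyDiscrete {d : ℕ} {S : Set (EuclideanSpace ℝ (Fin d))} (hS : FLC S) :
    UniformlyDiscrete S := by
  have hfin : (((S - S) ∩ Metric.closedBall 0 1) \ {0}).Finite :=
    (hS _ (isCompact_closedBall 0 1)).subset Set.sdiff_subset
  obtain ⟨ε, hε, hball⟩ := Metric.isOpen_iff.1 hfin.isClosed.isOpen_compl 0 (by simp)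
  refine ⟨min ε 1, lt_min hε one_pos, fun x hx y hy hxy => ?_⟩
  by_contra! hlt
  rw [dist_eq_norm] at hlt
  refine hball (show x - y ∈ Metric.ball 0 ε from ?_) ⟨⟨Set.sub_mem_sub hx hy, ?_⟩, ?_⟩
  · simpa using hlt.trans_le (min_le_left _ _)
  · simpa using (hlt.trans_le (min_le_right _ _)).le
  · simpa [sub_eq_zero] using hxy

theorem FLC.homImage_of_norm_sub_le {d m : ℕ} {M : Set (EuclideanSpace ℝ (Fin d))} (hM : FLC M)
    (f : (AddSubgroup.closure M) →+ EuclideanSpace ℝ (Fin m))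
    (F : EuclideanSpace ℝ (Fin d) ≃ₗ[ℝ] EuclideanSpace ℝ (Fin m)) (C : ℝ)
    (hFf : ∀ (x : EuclideanSpace ℝ (Fin d)) (hx : x ∈ M),
      ‖F x - f ⟨x, AddSubgroup.subset_closure hx⟩‖ ≤ C) :
    FLC (homImage f M) := by
  intro K hK
  obtain ⟨R, hR⟩ := hK.isBounded.exists_norm_le
  have hcompact : IsCompact (F.symm '' Metric.closedBall 0 (R + 2 * C)) :=
    (isCompact_closedBall 0 (R + 2 * C)).image
      (LinearMap.continuous_of_finiteDimensional F.symm.toLinearMap)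
  refine (((hM _ hcompact).preimage Subtype.val_injective.injOn).image f).subset ?_
  rintro _ ⟨⟨_, ⟨x, hx, rfl⟩, _, ⟨y, hy, rfl⟩, rfl⟩, hz⟩
  refine ⟨x - y, ⟨Set.sub_mem_sub hx hy, F (x - y), ?_, by simp⟩, map_sub f x y⟩
  have hzR : ‖f x - f y‖ ≤ R := hR _ hz
  have hxC : ‖F x - f x‖ ≤ C := hFf x hx
  have hyC : ‖F y - f y‖ ≤ C := hFf y hy
  rw [mem_closedBall_zero_iff]
  calc ‖F (x - y)‖ = ‖(f x - f y) + ((F x - f x) - (F y - f y))‖ := by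
        rw [map_sub]; congr 1; abel
    _ ≤ ‖f x - f y‖ + (‖F x - f x‖ + ‖F y - f y‖) :=
        (norm_add_le _ _).trans (by gcongr; exact norm_sub_le _ _)
    _ ≤ R + 2 * C := by linarith

/-- If `M` has finite local complexity and the homomorphism `f : [M] → ℝ^d` is uniformly
approximated on `M` by a linear isomorphism `F`, then `f(M)` has finite local complexity
and in particular is uniformly discrete. -/
theorem deformation_flc {d : ℕ} (M : Set (EuclideanSpace ℝ (Fin d)))
    (hM : FLC M)
    (f : (AddSubgroup.closure M) →+ EuclideanSpace ℝ (Fin d))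
    (F : EuclideanSpace ℝ (Fin d) ≃ₗ[ℝ] EuclideanSpace ℝ (Fin d)) (C : ℝ)
    (hFf : ∀ (x : EuclideanSpace ℝ (Fin d)) (hx : x ∈ M),
      ‖F x - f ⟨x, AddSubgroup.subset_closure hx⟩‖ ≤ C) :
    FLC (homImage f M) ∧ UniformlyDiscrete (homImage f M) := by
  have himage := hM.homImage_of_norm_sub_le f F C hFf
  exact ⟨himage, himage.uniformlyDiscrete⟩
end

section
/- Let M ⊆ ℝ^d be a Meyer set, let (A_m)_{m≥1} be a van Hove sequence in ℝ^d, let f : [M] → ℝ^d be an additive group homomorphism that is injective, and let F : ℝ^d → ℝ^d be a linear isomorphism with ‖F(y) − f(y)‖ uniformly bounded over y ∈ M − M + M. Then for every N ⊆ M − M + M for which dens_{(A_m)}(N) := lim_{m→∞} card(N ∩ A_m)/vol(A_m) exists, the density of f(N) along the van Hove sequence (F(A_m)) exists and equals dens_{(A_m)}(N)/|det F|. -/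
open scoped Pointwise
open MeasureTheory Filter Topology

/-- The `K`-boundary of a set `A`:
`∂^K A = ((K + A) \ A°) ∪ ((-K + closure(Aᶜ)) ∩ A)`. -/
def KBoundary {d : ℕ} (K A : Set (EuclideanSpace ℝ (Fin d))) :
    Set (EuclideanSpace ℝ (Fin d)) :=
  ((K + A) \ interior A) ∪ ((-K + closure Aᶜ) ∩ A)

/-- A van Hove sequence: measurable sets with compact closure and positive volume,
whose `K`-boundaries have asymptotically negligible relative volume for every compact `K`. -/
def IsVanHove {d : ℕ} (A : ℕ → Set (EuclideanSpace ℝ (Fin d))) : Prop :=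
  (∀ m, MeasurableSet (A m)) ∧ (∀ m, IsCompact (closure (A m))) ∧
    (∀ m, 0 < volume (A m)) ∧
    ∀ K : Set (EuclideanSpace ℝ (Fin d)), IsCompact K →
      Tendsto (fun m => (volume (KBoundary K (A m))).toReal / (volume (A m)).toReal)
        atTop (𝓝 0)

/-- A packing bound: a separated set all of whose small balls lie in `S` is finite, with
cardinality controlled by the volume of `S`. -/
theorem ncard_mul_volume_ball_le {d : ℕ} {T S : Set (EuclideanSpace ℝ (Fin d))} {s : ℝ}
    (hs : 0 < s) (hT : ∀ x ∈ T, ∀ y ∈ T, x ≠ y → 2 * s ≤ dist x y)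
    (hTS : ∀ x ∈ T, Metric.ball x s ⊆ S) (hS : volume S ≠ ⊤) :
    T.Finite ∧
      (T.ncard : ℝ) * (volume (Metric.ball (0 : EuclideanSpace ℝ (Fin d)) s)).toReal
        ≤ (volume S).toReal := by
  set b := (volume (Metric.ball (0 : EuclideanSpace ℝ (Fin d)) s)).toReal with hb
  have hbpos : 0 < b :=
    ENNReal.toReal_pos (Metric.measure_ball_pos volume _ hs).ne' measure_ball_lt_top.ne
  have key : ∀ t : Finset (EuclideanSpace ℝ (Fin d)), (t : Set _) ⊆ T →
      (t.card : ℝ) * b ≤ (volume S).toReal := by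
    intro t ht
    have hdisj : (t : Set (EuclideanSpace ℝ (Fin d))).PairwiseDisjoint
        (fun x => Metric.ball x s) := by
      intro x hx y hy hxy
      exact Metric.ball_disjoint_ball (by linarith [hT x (ht hx) y (ht hy) hxy])
    have h1 : volume (⋃ x ∈ t, Metric.ball x s)
        = t.card * volume (Metric.ball (0 : EuclideanSpace ℝ (Fin d)) s) := by
      rw [measure_biUnion_finset hdisj (fun _ _ => measurableSet_ball),
        Finset.sum_congr rfl (fun x _ => Measure.addHaar_ball_center volume x s)]
      simp
    have h2 : volume (⋃ x ∈ t, Metric.ball x s) ≤ volume S :=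
      measure_mono (Set.iUnion₂_subset fun x hx => hTS x (ht hx))
    rw [h1] at h2
    simpa [hb] using ENNReal.toReal_mono hS h2
  have hfin : T.Finite := by
    by_contra hinf
    obtain ⟨n, hn⟩ := exists_nat_gt ((volume S).toReal / b)
    obtain ⟨t, htT, htc⟩ := Set.Infinite.exists_subset_card_eq hinf n
    have := key t htT
    rw [htc] at this
    rw [div_lt_iff₀ hbpos] at hn
    linarith
  refine ⟨hfin, ?_⟩
  have := key hfin.toFinset (by simp)
  rwa [← Set.ncard_eq_toFinset_card T hfin] at this

/-- A uniformly discrete set has finitely many points in each ball, with a bound on their number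
independent of the centre. -/
theorem UniformlyDiscrete.exists_ncard_le {d : ℕ} {T : Set (EuclideanSpace ℝ (Fin d))}
    (hT : UniformlyDiscrete T) (ρ : ℝ) :
    ∃ K : ℕ, ∀ p, (T ∩ Metric.closedBall p ρ).Finite ∧
      (T ∩ Metric.closedBall p ρ).ncard ≤ K := by
  obtain ⟨r, hr, hsep⟩ := hT
  have hbpos : 0 < (volume (Metric.ball (0 : EuclideanSpace ℝ (Fin d)) (r / 2))).toReal :=
    ENNReal.toReal_pos (Metric.measure_ball_pos volume _ (by positivity)).ne'
      measure_ball_lt_top.ne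
  obtain ⟨K, hK⟩ := exists_nat_ge
    ((volume (Metric.ball (0 : EuclideanSpace ℝ (Fin d)) (ρ + r / 2))).toReal /
      (volume (Metric.ball (0 : EuclideanSpace ℝ (Fin d)) (r / 2))).toReal)
  refine ⟨K, fun p => ?_⟩
  have := ncard_mul_volume_ball_le (T := T ∩ Metric.closedBall p ρ)
    (S := Metric.ball p (ρ + r / 2)) (s := r / 2) (by positivity)
    (fun x hx y hy hxy => by linarith [hsep x hx.1 y hy.1 hxy])
    (fun x hx => Metric.ball_subset_ball' (by linarith [Metric.mem_closedBall.1 hx.2]))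
    measure_ball_lt_top.ne
  refine ⟨this.1, ?_⟩
  have h2 := this.2
  rw [Measure.addHaar_ball_center volume p, ← le_div_iff₀ hbpos] at h2
  exact_mod_cast h2.trans hK

/-- If finitely many differences of points of `T` are short, then `T` is uniformly discrete. -/
theorem uniformlyDiscrete_of_finite_sub {d : ℕ} {T : Set (EuclideanSpace ℝ (Fin d))}
    (hT : ((T - T) ∩ Metric.closedBall 0 1).Finite) : UniformlyDiscrete T := by
  have hfin := hT.subset (Set.sdiff_subset (t := {0}))
  obtain ⟨ε, hε, hball⟩ := Metric.isOpen_iff.1 hfin.isClosed.isOpen_compl 0 (by simp)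
  refine ⟨min ε 1, by positivity, fun x hx y hy hxy => ?_⟩
  by_contra! h
  have h1 : dist x y < ε := h.trans_le (min_le_left _ _)
  have h2 : dist x y ≤ 1 := (h.trans_le (min_le_right _ _)).le
  refine hball (a := x - y) (by simpa [← dist_eq_norm] using h1) ⟨⟨Set.sub_mem_sub hx hy, ?_⟩, ?_⟩
  · simpa [← dist_eq_norm] using h2
  · simpa [sub_eq_zero] using hxy

theorem SimpleGraph.Walk.sub_mem_nsmul {E V : Type*} [AddCommGroup E] {H : Set E} {φ : V → E}
    {G : SimpleGraph V} (hG : ∀ a b, G.Adj a b → φ b - φ a ∈ H) {a b : V} (p : G.Walk a b) :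
    φ b - φ a ∈ p.length • H := by
  induction p with
  | nil => simp
  | cons h p ih =>
    rw [SimpleGraph.Walk.length_cons, succ_nsmul]
    exact Set.mem_add.2 ⟨_, ih, _, hG _ _ h, by abel⟩

/-- A walk inside a finite set `S` with steps in `H` can be shortened to one with at most
`S.ncard` steps. -/
theorem sub_mem_nsmul_of_chain {E : Type*} [AddCommGroup E] {S H : Set E} (hS : S.Finite)
    (h0 : (0 : E) ∈ H) (hsymm : ∀ h ∈ H, -h ∈ H) {K : ℕ} (hK : S.ncard ≤ K) {n : ℕ} (e : ℕ → E)
    (heS : ∀ i ≤ n, e i ∈ S) (heH : ∀ i < n, e (i + 1) - e i ∈ H) :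
    e n - e 0 ∈ K • H := by
  classical
  have := hS.fintype
  let G : SimpleGraph S :=
    { Adj := fun a b => a ≠ b ∧ (b : E) - a ∈ H
      symm := ⟨fun a b h => ⟨h.1.symm, by simpa using hsymm _ h.2⟩⟩
      loopless := ⟨fun a h => h.1 rfl⟩ }
  have hreach : ∀ i (hi : i ≤ n), G.Reachable ⟨e 0, heS 0 n.zero_le⟩ ⟨e i, heS i hi⟩ := by
    intro i
    induction i with
    | zero => exact fun _ => SimpleGraph.Reachable.refl _
    | succ i ih =>
      intro hi
      refine (ih (by omega)).trans ?_
      by_cases h : (⟨e i, heS i (by omega)⟩ : S) = ⟨e (i + 1), heS _ hi⟩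
      · rw [h]
      · exact SimpleGraph.Adj.reachable ⟨h, heH i hi⟩
  obtain ⟨p, hp⟩ := (hreach n le_rfl).exists_isPath
  have hlen : p.length ≤ K := by
    have := hp.length_lt
    rw [← Nat.card_eq_fintype_card, Nat.card_coe_set_eq] at this
    omega
  have hmem := SimpleGraph.Walk.sub_mem_nsmul (G := G) (H := H) (φ := fun a : S => (a : E))
    (fun a b h => h.2) p
  exact Set.nsmul_subset_nsmul_right h0 hlen hmem

/-- Segments with almost equal directions are followed by parallel chains of points of `M`;
as the difference of the two chains stays in a ball, the difference of the difference vectors is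
a bounded sum of short differences. -/
theorem IsMeyer.finite_sub_sub_sub {d : ℕ} {M : Set (EuclideanSpace ℝ (Fin d))} (hM : IsMeyer M)
    (R : ℝ) : (((M - M) - (M - M)) ∩ Metric.closedBall 0 R).Finite := by
  obtain ⟨⟨R₀, hR₀, hnear⟩, hUD⟩ := hM
  choose near hnearM hnear using hnear
  obtain ⟨K, hK⟩ := hUD.exists_ncard_le (R + 2 * R₀)
  obtain ⟨_, hK'⟩ := hUD.exists_ncard_le (2 * R₀ + 1)
  set G := (M - M) ∩ Metric.closedBall 0 (2 * R₀ + 1)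
  have hGfin : G.Finite := (hK' 0).1
  have hmemG : ∀ a ∈ M, ∀ b ∈ M, dist a b ≤ 2 * R₀ + 1 → a - b ∈ G := fun a ha b hb h =>
    ⟨Set.sub_mem_sub ha hb, by simpa [← dist_eq_norm] using h⟩
  set H := G - G
  have h0 : (0 : EuclideanSpace ℝ (Fin d)) ∈ H :=
    Set.mem_sub.2 ⟨0, by simpa using hmemG _ (hnearM 0) _ (hnearM 0) (by simp; positivity), 0,
      by simpa using hmemG _ (hnearM 0) _ (hnearM 0) (by simp; positivity), by simp⟩
  have hsymm : ∀ h ∈ H, -h ∈ H := by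
    rintro _ ⟨a, ha, b, hb, rfl⟩
    exact ⟨b, hb, a, ha, by simp⟩
  have hHfin : H.Finite := hGfin.sub hGfin
  have hKfin : ∀ k : ℕ, (k • H).Finite := by
    intro k
    induction k with
    | zero => simp
    | succ k ih => rw [succ_nsmul]; exact ih.add hHfin
  refine (((hKfin K).add hHfin).sub hHfin).subset ?_
  rintro _ ⟨⟨_, ⟨x, hx, y, hy, rfl⟩, _, ⟨w, hw, z, hz, rfl⟩, rfl⟩, hR⟩
  have hR' : ‖(x - y) - (w - z)‖ ≤ R := by simpa using hR
  obtain ⟨n, hn⟩ := exists_nat_ge (max (max ‖x - y‖ ‖w - z‖) 1)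
  have hn1 : (1 : ℝ) ≤ n := (le_max_right _ _).trans hn
  have hnpos : (0 : ℝ) < n := by linarith
  have hnu : ‖x - y‖ ≤ n := (le_max_left _ _).trans ((le_max_left _ _).trans hn)
  have hnv : ‖w - z‖ ≤ n := (le_max_right _ _).trans ((le_max_left _ _).trans hn)
  let c (y u : EuclideanSpace ℝ (Fin d)) (i : ℕ) : EuclideanSpace ℝ (Fin d) :=
    y + ((i : ℝ) / n) • u
  have hstep : ∀ y u : EuclideanSpace ℝ (Fin d), ‖u‖ ≤ n → ∀ i,
      near (c y u (i + 1)) - near (c y u i) ∈ G := by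
    intro y u hu i
    refine hmemG _ (hnearM _) _ (hnearM _) ?_
    have h1 := hnear (c y u (i + 1))
    have h2 := hnear (c y u i)
    have h3 : dist (c y u (i + 1)) (c y u i) ≤ 1 := by
      have : c y u (i + 1) - c y u i = ((1 : ℝ) / n) • u := by
        simp only [c]
        rw [add_sub_add_left_eq_sub, ← sub_smul]
        push_cast
        congr 1
        ring
      rw [dist_eq_norm, this, norm_smul, Real.norm_of_nonneg (by positivity), one_div,
        inv_mul_le_iff₀ hnpos]
      linarith
    have h4 := dist_triangle4 (near (c y u (i + 1))) (c y u (i + 1)) (c y u i) (near (c y u i))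
    rw [dist_comm (c y u i)] at h4
    linarith
  have hend : ∀ a ∈ M, ∀ p, a = p → a - near p ∈ G := by
    rintro a ha _ rfl
    exact hmemG _ ha _ (hnearM _) (by rw [dist_comm]; linarith [hnear a])
  have hchain := sub_mem_nsmul_of_chain (S := (M - M) ∩ Metric.closedBall (y - z) (R + 2 * R₀))
    (hK _).1 h0 hsymm (hK _).2 (n := n) (fun i => near (c y (x - y) i) - near (c z (w - z) i))
    (fun i hi => by
      refine ⟨Set.sub_mem_sub (hnearM _) (hnearM _), ?_⟩
      have h1 := hnear (c y (x - y) i)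
      have h2 := hnear (c z (w - z) i)
      rw [dist_eq_norm] at h1 h2
      rw [mem_closedBall_iff_norm]
      have hsplit : near (c y (x - y) i) - near (c z (w - z) i) - (y - z) =
          (near (c y (x - y) i) - c y (x - y) i) - (near (c z (w - z) i) - c z (w - z) i) +
            ((i : ℝ) / n) • ((x - y) - (w - z)) := by
        rw [smul_sub]
        simp only [c]
        abel
      have hin : (i : ℝ) / n ≤ 1 := by
        rw [div_le_one hnpos]
        exact_mod_cast hi
      have h3 : ‖((i : ℝ) / n) • ((x - y) - (w - z))‖ ≤ R := by
        rw [norm_smul, Real.norm_of_nonneg (by positivity)]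
        exact (mul_le_of_le_one_left (norm_nonneg _) hin).trans hR'
      rw [hsplit]
      refine (norm_add_le _ _).trans ?_
      linarith [norm_sub_le (near (c y (x - y) i) - c y (x - y) i)
        (near (c z (w - z) i) - c z (w - z) i)])
    (fun i _ => ⟨_, hstep y _ hnu i, _, hstep z _ hnv i, by
      beta_reduce
      abel⟩)
  refine ⟨_, ⟨_, hchain, _, ⟨x - near (c y (x - y) n), hend x hx _ ?_,
      w - near (c z (w - z) n), hend w hw _ ?_, rfl⟩, rfl⟩, _,
    ⟨y - near (c y (x - y) 0), hend y hy _ ?_, z - near (c z (w - z) 0), hend z hz _ ?_, rfl⟩, ?_⟩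
  · simp [c, div_self hnpos.ne']
  · simp [c, div_self hnpos.ne']
  · simp [c]
  · simp [c]
  · beta_reduce
    abel

/-- The difference set of a Meyer set is covered by finitely many translates of the set. -/
theorem IsMeyer.exists_sub_subset_add_finite {d : ℕ} {M : Set (EuclideanSpace ℝ (Fin d))}
    (hM : IsMeyer M) : ∃ Φ : Set (EuclideanSpace ℝ (Fin d)), Φ.Finite ∧ M - M ⊆ M + Φ := by
  obtain ⟨R, hR, hnear⟩ := hM.1
  obtain ⟨m₀, hm₀, -⟩ := hnear 0
  refine ⟨_, (hM.finite_sub_sub_sub (R + ‖m₀‖)).image (fun v => v - m₀), ?_⟩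
  rintro _ ⟨x, hx, y, hy, rfl⟩
  obtain ⟨z, hz, hzR⟩ := hnear (x - y)
  refine ⟨z, hz, _, ⟨(x - y) - (z - m₀), ⟨Set.sub_mem_sub (Set.sub_mem_sub hx hy)
    (Set.sub_mem_sub hz hm₀), ?_⟩, rfl⟩, ?_⟩
  · rw [mem_closedBall_zero_iff]
    rw [dist_comm, dist_eq_norm] at hzR
    have : (x - y) - (z - m₀) = (x - y - z) + m₀ := by abel
    rw [this]
    exact (norm_add_le _ _).trans (by linarith)
  · beta_reduce
    abel

theorem IsMeyer.uniformlyDiscrete_sub_add {d : ℕ} {M : Set (EuclideanSpace ℝ (Fin d))}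
    (hM : IsMeyer M) : UniformlyDiscrete (M - M + M) := by
  obtain ⟨Φ, hΦ, hsub⟩ := hM.exists_sub_subset_add_finite
  refine uniformlyDiscrete_of_finite_sub ?_
  have hΨ : (Φ - Φ).Finite := hΦ.sub hΦ
  obtain ⟨ρ, hρ⟩ := hΨ.isBounded.exists_norm_le
  refine ((hM.finite_sub_sub_sub (1 + ρ)).add hΨ).subset ?_
  rintro _ ⟨⟨_, ⟨_, ⟨x, hx, y, hy, rfl⟩, z, hz, rfl⟩, _,
    ⟨_, ⟨x', hx', y', hy', rfl⟩, z', hz', rfl⟩, rfl⟩, h1⟩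
  obtain ⟨a, ha, φ, hφ, hxy⟩ := hsub (Set.sub_mem_sub hx hy)
  obtain ⟨a', ha', φ', hφ', hxy'⟩ := hsub (Set.sub_mem_sub hx' hy')
  beta_reduce at hxy hxy' h1 ⊢
  rw [← hxy, ← hxy'] at h1 ⊢
  have heq : a + φ + z - (a' + φ' + z') = ((a - a') - (z' - z)) + (φ - φ') := by abel
  rw [heq] at h1 ⊢
  refine ⟨_, ⟨Set.sub_mem_sub (Set.sub_mem_sub ha ha') (Set.sub_mem_sub hz' hz), ?_⟩, _,
    Set.sub_mem_sub hφ hφ', rfl⟩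
  rw [mem_closedBall_zero_iff] at h1 ⊢
  have h2 := hρ _ (Set.sub_mem_sub hφ hφ')
  have h3 := norm_sub_le ((a - a') - (z' - z) + (φ - φ')) (φ - φ')
  rw [add_sub_cancel_right] at h3
  linarith

/-- Points separated by `A` from a point at distance at most `c` lie well inside the
`K`-boundary of `A`. -/
theorem ball_subset_KBoundary {d : ℕ} {A : Set (EuclideanSpace ℝ (Fin d))}
    {x y : EuclideanSpace ℝ (Fin d)} {c s : ℝ} (hc : 0 ≤ c) (hxy : dist y x ≤ c)
    (hA : ¬(x ∈ A ↔ y ∈ A)) :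
    Metric.ball x s ⊆ KBoundary (Metric.closedBall 0 (c + s)) A := by
  intro p hp
  have hpx : dist p x ≤ c + s := by linarith [Metric.mem_ball.1 hp]
  have hpy : dist p y ≤ c + s := by
    linarith [Metric.mem_ball.1 hp, dist_triangle p x y, dist_comm x y]
  have hin : ∃ q ∈ A, dist p q ≤ c + s := by
    by_cases h : x ∈ A
    · exact ⟨x, h, hpx⟩
    · exact ⟨y, by tauto, hpy⟩
  have hout : ∃ q ∈ Aᶜ, dist p q ≤ c + s := by
    by_cases h : x ∈ A
    · exact ⟨y, by simp only [Set.mem_compl_iff]; tauto, hpy⟩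
    · exact ⟨x, h, hpx⟩
  by_cases hpA : p ∈ interior A
  · obtain ⟨q, hq, hpq⟩ := hout
    refine Or.inr ⟨⟨p - q, ?_, q, subset_closure hq, by simp⟩, interior_subset hpA⟩
    simpa [← dist_eq_norm, dist_comm q p] using hpq
  · obtain ⟨q, hq, hpq⟩ := hin
    exact Or.inl ⟨⟨p - q, by simpa [← dist_eq_norm] using hpq, q, hq, by simp⟩, hpA⟩

theorem volume_KBoundary_ne_top {d : ℕ} {K A : Set (EuclideanSpace ℝ (Fin d))}
    (hK : IsCompact K) (hA : Bornology.IsBounded A) : volume (KBoundary K A) ≠ ⊤ := by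
  have hsub : KBoundary K A ⊆ (K + A) ∪ A :=
    Set.union_subset_union Set.sdiff_subset Set.inter_subset_right
  exact (((hK.isBounded.add hA).union hA).subset hsub).measure_lt_top.ne

/-- A perturbation moving each point of a uniformly discrete set `N` by a bounded amount changes
the number of points in `A` by at most a multiple of the volume of a `K`-boundary of `A`. -/
theorem UniformlyDiscrete.exists_abs_ncard_sub_le {d : ℕ}
    {N : Set (EuclideanSpace ℝ (Fin d))} (hN : UniformlyDiscrete N)
    (g : EuclideanSpace ℝ (Fin d) → EuclideanSpace ℝ (Fin d)) {c : ℝ} (hc : 0 ≤ c)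
    (hg : ∀ x ∈ N, dist (g x) x ≤ c) :
    ∃ B : ℝ, ∃ K : Set (EuclideanSpace ℝ (Fin d)), IsCompact K ∧
      ∀ A : Set (EuclideanSpace ℝ (Fin d)), Bornology.IsBounded A →
        |(({x ∈ N | g x ∈ A}.ncard : ℝ)) - ((N ∩ A).ncard : ℝ)|
          ≤ B * (volume (KBoundary K A)).toReal := by
  obtain ⟨r, hr, hsep⟩ := id hN
  have hbpos : 0 < (volume (Metric.ball (0 : EuclideanSpace ℝ (Fin d)) (r / 2))).toReal :=
    ENNReal.toReal_pos (Metric.measure_ball_pos volume _ (by positivity)).ne'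
      measure_ball_lt_top.ne
  refine ⟨((volume (Metric.ball (0 : EuclideanSpace ℝ (Fin d)) (r / 2))).toReal)⁻¹,
    Metric.closedBall 0 (c + r / 2), isCompact_closedBall _ _, fun A hA => ?_⟩
  set P := {x ∈ N | g x ∈ A}
  set Q := N ∩ A
  set D := {x ∈ N | ¬(x ∈ A ↔ g x ∈ A)}
  obtain ⟨hDfin, hDcard⟩ := ncard_mul_volume_ball_le (T := D) (s := r / 2) (by positivity)
    (fun x hx y hy hxy => by linarith [hsep x hx.1 y hy.1 hxy])
    (fun x hx => ball_subset_KBoundary hc (hg x hx.1) hx.2)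
    (volume_KBoundary_ne_top (isCompact_closedBall _ _) hA)
  have hQfin : Q.Finite := by
    obtain ⟨ρ, hρ⟩ := hA.subset_closedBall 0
    obtain ⟨_, hfin⟩ := hN.exists_ncard_le ρ
    exact (hfin 0).1.subset (Set.inter_subset_inter_right _ hρ)
  have hPQ : P ⊆ Q ∪ D := by
    rintro x ⟨hx, hgx⟩
    by_cases h : x ∈ A
    · exact Or.inl ⟨hx, h⟩
    · exact Or.inr ⟨hx, by tauto⟩
  have hQP : Q ⊆ P ∪ D := by
    rintro x ⟨hx, h⟩
    by_cases hgx : g x ∈ A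
    · exact Or.inl ⟨hx, hgx⟩
    · exact Or.inr ⟨hx, by tauto⟩
  have hPfin : P.Finite := (hQfin.union hDfin).subset hPQ
  have h1 : (P.ncard : ℝ) ≤ Q.ncard + D.ncard := by
    exact_mod_cast (Set.ncard_le_ncard hPQ (hQfin.union hDfin)).trans (Set.ncard_union_le _ _)
  have h2 : (Q.ncard : ℝ) ≤ P.ncard + D.ncard := by
    exact_mod_cast (Set.ncard_le_ncard hQP (hPfin.union hDfin)).trans (Set.ncard_union_le _ _)
  rw [inv_mul_eq_div]
  refine le_trans ?_ ((le_div_iff₀ hbpos).2 hDcard)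
  rw [abs_le]
  constructor <;> linarith

/-- For `N ⊆ M - M + M`, whenever the density of `N` along the van Hove sequence `(A_m)`
exists and equals `L`, the density of `f(N)` along `(F(A_m))` exists and equals
`L / |det F|`. -/
theorem deformation_density {d : ℕ} (M : Set (EuclideanSpace ℝ (Fin d)))
    (hM : IsMeyer M)
    (A : ℕ → Set (EuclideanSpace ℝ (Fin d))) (hA : IsVanHove A)
    (f : (AddSubgroup.closure M) →+ EuclideanSpace ℝ (Fin d))
    (hf : Function.Injective f)
    (F : EuclideanSpace ℝ (Fin d) ≃ₗ[ℝ] EuclideanSpace ℝ (Fin d)) (C : ℝ)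
    (hFf : ∀ (x₁ x₂ x₃ : EuclideanSpace ℝ (Fin d))
      (hx₁ : x₁ ∈ M) (hx₂ : x₂ ∈ M) (hx₃ : x₃ ∈ M),
      ‖F (x₁ - x₂ + x₃) -
          f (⟨x₁, AddSubgroup.subset_closure hx₁⟩ - ⟨x₂, AddSubgroup.subset_closure hx₂⟩ +
              ⟨x₃, AddSubgroup.subset_closure hx₃⟩)‖ ≤ C)
    (N : Set (EuclideanSpace ℝ (Fin d))) (hN : N ⊆ M - M + M) (L : ℝ)
    (hdens : Tendsto (fun m => (Nat.card ↥(N ∩ A m) : ℝ) / (volume (A m)).toReal)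
      atTop (𝓝 L)) :
    Tendsto (fun m =>
        (Nat.card ↥(homImage f N ∩
            (F : EuclideanSpace ℝ (Fin d) → EuclideanSpace ℝ (Fin d)) '' A m) : ℝ) /
          (volume ((F : EuclideanSpace ℝ (Fin d) → EuclideanSpace ℝ (Fin d)) '' A m)).toReal)
      atTop (𝓝 (L / |LinearMap.det F.toLinearMap|)) := by
  classical
  have hmem : ∀ x ∈ N, x ∈ AddSubgroup.closure M := by
    intro x hx
    obtain ⟨_, ⟨a, ha, b, hb, rfl⟩, c, hc, rfl⟩ := hN hx
    exact add_mem (sub_mem (AddSubgroup.subset_closure ha) (AddSubgroup.subset_closure hb))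
      (AddSubgroup.subset_closure hc)
  have hFfN : ∀ x (hx : x ∈ N), ‖F x - f ⟨x, hmem x hx⟩‖ ≤ C := by
    intro x hx
    obtain ⟨_, ⟨a, ha, b, hb, rfl⟩, c, hc, rfl⟩ := hN hx
    exact hFf a b c ha hb hc
  have hNUD : UniformlyDiscrete N := by
    obtain ⟨r, hr, hsep⟩ := hM.uniformlyDiscrete_sub_add
    exact ⟨r, hr, fun x hx y hy => hsep x (hN hx) y (hN hy)⟩
  let g : EuclideanSpace ℝ (Fin d) → EuclideanSpace ℝ (Fin d) := fun x =>
    if hx : x ∈ AddSubgroup.closure M then F.symm (f ⟨x, hx⟩) else x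
  let Fi : EuclideanSpace ℝ (Fin d) →L[ℝ] EuclideanSpace ℝ (Fin d) :=
    F.symm.toLinearMap.toContinuousLinearMap
  have hg : ∀ x ∈ N, dist (g x) x ≤ ‖Fi‖ * |C| := by
    intro x hx
    have hx' : g x - x = Fi (f ⟨x, hmem x hx⟩ - F x) := by
      simp [g, hmem x hx, Fi]
    rw [dist_eq_norm, hx']
    refine Fi.le_opNorm_of_le ?_
    rw [norm_sub_rev]
    exact (hFfN x hx).trans (le_abs_self C)
  obtain ⟨B, K, hK, hcount⟩ := hNUD.exists_abs_ncard_sub_le g (by positivity) hg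
  obtain ⟨-, hAc, -, hAK⟩ := hA
  have hcard : ∀ m, Nat.card ↥(homImage f N ∩ F '' A m) = {x ∈ N | g x ∈ A m}.ncard := by
    intro m
    rw [Nat.card_coe_set_eq]
    have : F '' {x ∈ N | g x ∈ A m}.image g = homImage f N ∩ F '' A m := by
      ext p
      constructor
      · rintro ⟨_, ⟨x, ⟨hx, hgx⟩, rfl⟩, rfl⟩
        exact ⟨⟨⟨x, hmem x hx⟩, hx, by simp [g, hmem x hx]⟩, g x, hgx, rfl⟩
      · rintro ⟨⟨x, hx, rfl⟩, a, ha, hax⟩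
        have hgx : g x = a := by simp [g, ← hax]
        exact ⟨a, ⟨x, ⟨hx, hgx ▸ ha⟩, hgx⟩, hax⟩
    rw [← this, Set.ncard_image_of_injective _ F.injective, Set.InjOn.ncard_image]
    intro x hx y hy hxy
    simp only [g, hmem x hx.1, hmem y hy.1, dite_true] at hxy
    simpa using hf (F.symm.injective hxy)
  have hdiff : Tendsto (fun m => (({x ∈ N | g x ∈ A m}.ncard : ℝ) - ((N ∩ A m).ncard : ℝ)) /
      (volume (A m)).toReal) atTop (𝓝 0) := by
    refine squeeze_zero_norm (fun m => ?_) (by simpa using (hAK K hK).const_mul B)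
    rw [norm_div, Real.norm_eq_abs, Real.norm_of_nonneg ENNReal.toReal_nonneg, ← mul_div_assoc]
    exact div_le_div_of_nonneg_right (hcount _ ((hAc m).isBounded.subset subset_closure))
      ENNReal.toReal_nonneg
  have hlim := (hdens.add hdiff).div_const |LinearMap.det F.toLinearMap|
  rw [add_zero] at hlim
  refine hlim.congr fun m => ?_
  have hvol : volume (F '' A m) = ENNReal.ofReal |LinearMap.det F.toLinearMap| * volume (A m) :=
    Measure.addHaar_image_linearMap volume F.toLinearMap (A m)
  rw [hvol, ENNReal.toReal_mul, ENNReal.toReal_ofReal (abs_nonneg _), hcard, Nat.card_coe_set_eq,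
    ← add_div, add_sub_cancel, div_div, mul_comm]
end

section
/- Let τ = (1 + √5)/2 and let M = { a + bτ : a, b ∈ ℤ, and a + b·(−1/τ) ∈ [0,1] } ⊆ ℝ. Then M is a Meyer set in ℝ, and the additive subgroup of ℝ generated by M is ℤ[τ] = {a + bτ : a, b ∈ ℤ}. -/
open scoped Pointwise

/-- A set of reals is relatively dense if there is `R > 0` such that every closed ball
of radius `R` meets the set. -/
def RelativelyDenseR (M : Set ℝ) : Prop :=
  ∃ R > (0 : ℝ), ∀ y : ℝ, ∃ x ∈ M, dist x y ≤ R

/-- A set of reals is uniformly discrete if distinct points are at distance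
at least `r > 0`. -/
def UniformlyDiscreteR (S : Set ℝ) : Prop :=
  ∃ r > (0 : ℝ), ∀ x ∈ S, ∀ y ∈ S, x ≠ y → r ≤ dist x y

/-- A Meyer set in `ℝ`: relatively dense with uniformly discrete difference set. -/
def IsMeyerR (M : Set ℝ) : Prop :=
  RelativelyDenseR M ∧ UniformlyDiscreteR (M - M)

/-- The golden ratio. -/
noncomputable def τ : ℝ := (1 + Real.sqrt 5) / 2

/-- The model set `M = {a + bτ : a, b ∈ ℤ, a + b·(-1/τ) ∈ [0,1]}`. -/
noncomputable def goldenM : Set ℝ :=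
  {x : ℝ | ∃ a b : ℤ, x = (a : ℝ) + (b : ℝ) * τ ∧
    (a : ℝ) + (b : ℝ) * (-1 / τ) ∈ Set.Icc (0 : ℝ) 1}

theorem tau_sq : τ ^ 2 = τ + 1 := by
  have h : Real.sqrt 5 ^ 2 = 5 := Real.sq_sqrt (by norm_num)
  unfold τ
  linear_combination h / 4

theorem one_lt_tau : 1 < τ := by
  have h : (1 : ℝ) < Real.sqrt 5 := Real.lt_sqrt_of_sq_lt (by norm_num)
  unfold τ
  linarith

theorem tau_lt_two : τ < 2 := by
  nlinarith [tau_sq, one_lt_tau]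

theorem neg_one_div_tau : -1 / τ = 1 - τ := by
  rw [div_eq_iff (by linarith [one_lt_tau])]
  linear_combination tau_sq

theorem irrational_tau : Irrational τ :=
  Real.goldenRatio_irrational

/-- An element of `ℤ[τ]` whose algebraic conjugate vanishes is zero. -/
theorem eq_zero_of_conj_eq_zero {a b : ℤ} (h : (a : ℝ) + b * (1 - τ) = 0) :
    (a : ℝ) + b * τ = 0 := by
  have hb : b = 0 := by
    by_contra hb
    have hirr : Irrational ((b : ℝ) * τ) := irrational_tau.intCast_mul hb
    refine hirr.ne_int (a + b) ?_
    push_cast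
    linear_combination -h
  subst hb
  simpa using h

/-- The absolute value of the norm of a nonzero element of `ℤ[τ]` is at least one. -/
theorem one_le_abs_mul_conj {a b : ℤ} (h : (a : ℝ) + b * τ ≠ 0) :
    1 ≤ |(a : ℝ) + b * τ| * |(a : ℝ) + b * (1 - τ)| := by
  have hN : ((a : ℝ) + b * τ) * (a + b * (1 - τ)) = ((a ^ 2 + a * b - b ^ 2 : ℤ) : ℝ) := by
    push_cast
    linear_combination -(b : ℝ) ^ 2 * tau_sq
  have hne : (a ^ 2 + a * b - b ^ 2 : ℤ) ≠ 0 := by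
    rw [← Int.cast_ne_zero (α := ℝ), ← hN]
    exact mul_ne_zero h fun h0 => h (eq_zero_of_conj_eq_zero h0)
  rw [← abs_mul, hN, ← Int.cast_abs]
  exact_mod_cast Int.one_le_abs hne

theorem mem_goldenM_iff {x : ℝ} :
    x ∈ goldenM ↔ ∃ a b : ℤ, x = (a : ℝ) + b * τ ∧
      0 ≤ (a : ℝ) + b * (1 - τ) ∧ (a : ℝ) + b * (1 - τ) ≤ 1 := by
  simp only [goldenM, Set.mem_ofPred_eq, Set.mem_Icc, neg_one_div_tau]

theorem relativelyDenseR_goldenM : RelativelyDenseR goldenM := by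
  refine ⟨4, by norm_num, fun y => ?_⟩
  have hd : 0 < 2 * τ - 1 := by linarith [one_lt_tau]
  set b : ℤ := ⌊y / (2 * τ - 1)⌋
  set a : ℤ := ⌈-((b : ℝ) * (1 - τ))⌉
  have ha : -((b : ℝ) * (1 - τ)) ≤ a := Int.le_ceil _
  have ha' : (a : ℝ) < -((b : ℝ) * (1 - τ)) + 1 := Int.ceil_lt_add_one _
  have hb : (b : ℝ) * (2 * τ - 1) ≤ y := (le_div_iff₀ hd).1 (Int.floor_le _)
  have hb' : y < ((b : ℝ) + 1) * (2 * τ - 1) := (div_lt_iff₀ hd).1 (Int.lt_floor_add_one _)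
  refine ⟨a + b * τ, mem_goldenM_iff.2 ⟨a, b, rfl, by linarith, by linarith⟩, ?_⟩
  rw [Real.dist_eq, abs_le]
  constructor <;> linarith [tau_lt_two]

theorem uniformlyDiscreteR_goldenM_sub_goldenM : UniformlyDiscreteR (goldenM - goldenM) := by
  refine ⟨1 / 2, by norm_num, ?_⟩
  rintro _ ⟨_, h₁, _, h₂, rfl⟩ _ ⟨_, h₃, _, h₄, rfl⟩ hne
  obtain ⟨a₁, b₁, rfl, l₁, u₁⟩ := mem_goldenM_iff.1 h₁
  obtain ⟨a₂, b₂, rfl, l₂, u₂⟩ := mem_goldenM_iff.1 h₂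
  obtain ⟨a₃, b₃, rfl, l₃, u₃⟩ := mem_goldenM_iff.1 h₃
  obtain ⟨a₄, b₄, rfl, l₄, u₄⟩ := mem_goldenM_iff.1 h₄
  set a : ℤ := a₁ - a₂ - (a₃ - a₄) with ha
  set b : ℤ := b₁ - b₂ - (b₃ - b₄) with hb
  have hx : (a₁ + b₁ * τ - (a₂ + b₂ * τ)) - (a₃ + b₃ * τ - (a₄ + b₄ * τ)) = a + b * τ := by
    rw [ha, hb]
    push_cast
    ring
  have hconj : |(a : ℝ) + b * (1 - τ)| ≤ 2 := by
    rw [ha, hb, abs_le]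
    push_cast
    constructor <;> linarith
  have hnz : (a : ℝ) + b * τ ≠ 0 := hx ▸ sub_ne_zero.2 hne
  change _ ≤ dist (_ - _) (_ - _)
  rw [Real.dist_eq, hx]
  nlinarith [one_le_abs_mul_conj hnz, abs_nonneg ((a : ℝ) + b * τ)]

theorem closure_goldenM :
    (AddSubgroup.closure goldenM : Set ℝ) =
      {x : ℝ | ∃ a b : ℤ, x = (a : ℝ) + (b : ℝ) * τ} := by
  ext x
  simp only [SetLike.mem_coe, Set.mem_ofPred_eq]
  constructor
  · intro hx
    induction hx using AddSubgroup.closure_induction with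
    | mem x hx =>
      obtain ⟨a, b, h, -⟩ := hx
      exact ⟨a, b, h⟩
    | zero => exact ⟨0, 0, by simp⟩
    | add x y _ _ hx hy =>
      obtain ⟨a, b, rfl⟩ := hx
      obtain ⟨c, d, rfl⟩ := hy
      exact ⟨a + c, b + d, by push_cast; ring⟩
    | neg x _ hx =>
      obtain ⟨a, b, rfl⟩ := hx
      exact ⟨-a, -b, by push_cast; ring⟩
  · rintro ⟨a, b, rfl⟩
    have h₁ : (1 : ℝ) ∈ goldenM := mem_goldenM_iff.2 ⟨1, 0, by simp, by simp, by simp⟩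
    have h₂ : 1 + τ ∈ goldenM := by
      refine mem_goldenM_iff.2 ⟨1, 1, by simp, ?_, ?_⟩ <;> push_cast <;>
        linarith [one_lt_tau, tau_lt_two]
    have h := add_mem (zsmul_mem (AddSubgroup.subset_closure h₁) (a - b))
      (zsmul_mem (AddSubgroup.subset_closure h₂) b)
    convert h using 1
    simp only [zsmul_eq_mul]
    push_cast
    ring

/-- `goldenM` is a Meyer set and generates the additive group `ℤ[τ]`. -/
theorem goldenM_isMeyer :
    IsMeyerR goldenM ∧
      (AddSubgroup.closure goldenM : Set ℝ) =
        {x : ℝ | ∃ a b : ℤ, x = (a : ℝ) + (b : ℝ) * τ} :=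
  ⟨⟨relativelyDenseR_goldenM, uniformlyDiscreteR_goldenM_sub_goldenM⟩, closure_goldenM⟩
end

section
/- Let τ = (1 + √5)/2, let M = { a + bτ : a, b ∈ ℤ, a + b·(−1/τ) ∈ [0,1] }, and let f : ℤ[τ] → ℝ be an additive group homomorphism. Then f(M) is a bounded subset of ℝ if and only if τ·f(τ) = −f(1), i.e., if and only if f is a real scalar multiple of the conjugation map a + bτ ↦ a + b·(−1/τ). -/
open scoped Pointwise

/-- The additive group `ℤ[τ]`, generated by `1` and `τ`. -/
noncomputable def Zτ : AddSubgroup ℝ := AddSubgroup.closure {1, τ}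

theorem one_mem_Zτ : (1 : ℝ) ∈ Zτ :=
  AddSubgroup.subset_closure (Set.mem_insert 1 {τ})

theorem tau_mem_Zτ : τ ∈ Zτ :=
  AddSubgroup.subset_closure (Set.mem_insert_of_mem 1 rfl)

theorem tau_pos : 0 < τ := by
  unfold τ
  positivity

theorem int_add_int_mul_tau_mem_Zτ (a b : ℤ) : (a : ℝ) + (b : ℝ) * τ ∈ Zτ := by
  simpa using add_mem (zsmul_mem one_mem_Zτ a) (zsmul_mem tau_mem_Zτ b)

/-- The part of `f (a + bτ)` not proportional to the conjugate of `a + bτ` is linear in `b`. -/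
theorem map_eq_conj_mul_add (f : Zτ →+ ℝ) (x : Zτ) (a b : ℤ)
    (hx : (x : ℝ) = (a : ℝ) + (b : ℝ) * τ) :
    f x = ((a : ℝ) + (b : ℝ) * (-1 / τ)) * f ⟨1, one_mem_Zτ⟩ +
      (b : ℝ) * (f ⟨τ, tau_mem_Zτ⟩ + f ⟨1, one_mem_Zτ⟩ / τ) := by
  have hx' : x = a • (⟨1, one_mem_Zτ⟩ : Zτ) + b • (⟨τ, tau_mem_Zτ⟩ : Zτ) :=
    Subtype.ext (by simpa using hx)
  rw [hx', map_add, map_zsmul, map_zsmul, zsmul_eq_mul, zsmul_eq_mul]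
  ring

theorem isBounded_image_goldenM_iff (f : Zτ →+ ℝ) :
    Bornology.IsBounded (f '' {x : Zτ | (x : ℝ) ∈ goldenM}) ↔
      f ⟨τ, tau_mem_Zτ⟩ + f ⟨1, one_mem_Zτ⟩ / τ = 0 := by
  set p := f ⟨1, one_mem_Zτ⟩ with hp
  set r := f ⟨τ, tau_mem_Zτ⟩ + p / τ with hr
  rw [isBounded_iff_forall_norm_le]
  constructor
  · rintro ⟨C, hC⟩
    by_contra hne
    obtain ⟨n, hn⟩ := exists_nat_gt ((C + |p|) / |r|)
    rw [div_lt_iff₀ (abs_pos.mpr hne)] at hn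
    set a : ℤ := ⌈(n : ℝ) / τ⌉
    have ha₀ := Int.le_ceil ((n : ℝ) / τ)
    have ha₁ := Int.ceil_lt_add_one ((n : ℝ) / τ)
    have hconj : (a : ℝ) + ((n : ℤ) : ℝ) * (-1 / τ) = a - n / τ := by
      push_cast
      ring
    have hmem : (a : ℝ) + ((n : ℤ) : ℝ) * (-1 / τ) ∈ Set.Icc (0 : ℝ) 1 := by
      rw [hconj]
      constructor <;> linarith
    have hbound := hC _ ⟨⟨_, int_add_int_mul_tau_mem_Zτ a n⟩, ⟨a, n, rfl, hmem⟩, rfl⟩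
    rw [map_eq_conj_mul_add f _ a n rfl, ← hp, ← hr, Real.norm_eq_abs] at hbound
    set s := (a : ℝ) + ((n : ℤ) : ℝ) * (-1 / τ)
    have hsp : |s * p| ≤ |p| := by
      rw [abs_mul, abs_of_nonneg hmem.1]
      exact mul_le_of_le_one_left (abs_nonneg p) hmem.2
    have hnr : |((n : ℤ) : ℝ) * r| = n * |r| := by
      rw [abs_mul, Int.cast_natCast, Nat.abs_cast]
    have htri := abs_sub (s * p + ((n : ℤ) : ℝ) * r) (s * p)
    rw [add_sub_cancel_left, hnr] at htri
    linarith
  · intro h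
    refine ⟨|p|, ?_⟩
    rintro _ ⟨x, ⟨a, b, hx, hmem⟩, rfl⟩
    rw [map_eq_conj_mul_add f x a b hx, ← hp, ← hr, h, mul_zero, add_zero, Real.norm_eq_abs,
      abs_mul, abs_of_nonneg hmem.1]
    exact mul_le_of_le_one_left (abs_nonneg p) hmem.2

/-- For an additive homomorphism `f : ℤ[τ] → ℝ`, the image `f(M)` is bounded
iff `τ · f(τ) = -f(1)`, i.e. iff `f` is a real scalar multiple of the conjugation map
`a + bτ ↦ a + b·(-1/τ)`. -/
theorem bounded_image_iff_conjugation (f : Zτ →+ ℝ) :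
    (Bornology.IsBounded (f '' {x : Zτ | (x : ℝ) ∈ goldenM}) ↔
        τ * f ⟨τ, tau_mem_Zτ⟩ = - f ⟨1, one_mem_Zτ⟩) ∧
      (Bornology.IsBounded (f '' {x : Zτ | (x : ℝ) ∈ goldenM}) ↔
        ∃ c : ℝ, f ⟨1, one_mem_Zτ⟩ = c * 1 ∧ f ⟨τ, tau_mem_Zτ⟩ = c * (-1 / τ)) := by
  have hτ := tau_pos.ne'
  rw [isBounded_image_goldenM_iff]
  refine ⟨?_, fun h => ⟨f ⟨1, one_mem_Zτ⟩, by ring, ?_⟩, ?_⟩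
  · rw [← mul_right_inj' hτ, mul_add, mul_div_cancel₀ _ hτ, mul_zero, eq_neg_iff_add_eq_zero]
  · linear_combination h
  · rintro ⟨c, h₁, h₂⟩
    rw [h₁, h₂]
    ring
end

section
/- Let M ⊆ ℝ^d be a Meyer set, let (A_m)_{m≥1} be a van Hove sequence such that dens(M) := lim_{m→∞} card(M ∩ A_m)/vol(A_m) exists and is positive, let ε be a real number with 0 < ε < 2·dens(M), and let t ∈ ℝ^d be such that dens_{(A_m)}((t + M) △ M) exists and is < ε. Then t ∈ M − M. -/
open scoped Pointwise symmDiff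
open MeasureTheory Filter Topology

theorem UniformlyDiscrete.of_sub {d : ℕ} {M : Set (EuclideanSpace ℝ (Fin d))}
    (h : UniformlyDiscrete (M - M)) : UniformlyDiscrete M := by
  obtain ⟨r, hr, h⟩ := h
  refine ⟨r, hr, fun x hx y hy hxy => ?_⟩
  simpa using h (x - x) (Set.sub_mem_sub hx hx) (y - x) (Set.sub_mem_sub hy hx)
    (by simpa [sub_eq_zero, eq_comm] using hxy)

theorem isBounded_kBoundary {d : ℕ} {K A : Set (EuclideanSpace ℝ (Fin d))}
    (hK : Bornology.IsBounded K) (hA : Bornology.IsBounded A) :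
    Bornology.IsBounded (KBoundary K A) :=
  ((hK.add hA).subset Set.sdiff_subset).union (hA.subset Set.inter_subset_right)

/-- Balls around the points of `A` that `t` moves out of `A` lie in a `K`-boundary of `A`. -/
theorem ball_subset_kBoundary {d : ℕ} {A : Set (EuclideanSpace ℝ (Fin d))}
    {t x : EuclideanSpace ℝ (Fin d)} {ρ : ℝ} (hx : x ∈ A) (hxt : t + x ∉ A) :
    Metric.ball x ρ ⊆ KBoundary (Metric.closedBall 0 (‖t‖ + ρ)) A := by
  intro y hy
  rw [mem_ball_iff_norm] at hy
  by_cases hyA : y ∈ A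
  · refine Or.inr ⟨Set.mem_add.2 ⟨y - (t + x), ?_, t + x, subset_closure hxt, by abel⟩, hyA⟩
    rw [Set.mem_neg, mem_closedBall_zero_iff, norm_neg]
    calc ‖y - (t + x)‖ = ‖(y - x) - t‖ := by congr 1; abel
      _ ≤ ‖y - x‖ + ‖t‖ := norm_sub_le _ _
      _ ≤ ‖t‖ + ρ := by linarith
  · refine Or.inl ⟨Set.mem_add.2 ⟨y - x, ?_, x, hx, by abel⟩, fun h => hyA (interior_subset h)⟩
    rw [mem_closedBall_zero_iff]
    linarith [norm_nonneg t]

theorem card_mul_volume_ball_le {d : ℕ} {S B : Set (EuclideanSpace ℝ (Fin d))} {r : ℝ}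
    (hS : ∀ x ∈ S, ∀ y ∈ S, x ≠ y → r ≤ dist x y)
    (hSB : ∀ x ∈ S, Metric.ball x (r / 2) ⊆ B)
    (hB : Bornology.IsBounded B) (hfin : S.Finite) :
    (Nat.card S : ℝ) * (volume (Metric.ball (0 : EuclideanSpace ℝ (Fin d)) (r / 2))).toReal
      ≤ (volume B).toReal := by
  have key : volume (⋃ x ∈ hfin.toFinset, Metric.ball x (r / 2)) ≤ volume B :=
    measure_mono (Set.iUnion₂_subset fun x hx => hSB x (hfin.mem_toFinset.1 hx))
  rw [measure_biUnion_finset] at key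
  · simp only [Measure.addHaar_ball_center, Finset.sum_const, nsmul_eq_mul] at key
    have := ENNReal.toReal_mono hB.measure_lt_top.ne key
    rwa [ENNReal.toReal_mul, ENNReal.toReal_natCast, ← Set.ncard_eq_toFinset_card S hfin] at this
  · intro x hx y hy hxy
    apply Metric.ball_disjoint_ball
    have := hS x (by simpa using hx) y (by simpa using hy) hxy
    linarith
  · exact fun _ _ => measurableSet_ball

theorem UniformlyDiscrete.finite_inter {d : ℕ} {M A : Set (EuclideanSpace ℝ (Fin d))}
    (hM : UniformlyDiscrete M) (hA : Bornology.IsBounded A) : (M ∩ A).Finite := by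
  obtain ⟨r, hr, hM⟩ := hM
  obtain ⟨c, hc⟩ : ∃ c : ℕ, (volume (Metric.thickening (r / 2) A)).toReal /
      (volume (Metric.ball (0 : EuclideanSpace ℝ (Fin d)) (r / 2))).toReal < c := exists_nat_gt _
  have hv : 0 < (volume (Metric.ball (0 : EuclideanSpace ℝ (Fin d)) (r / 2))).toReal :=
    ENNReal.toReal_pos (Metric.measure_ball_pos _ _ (by positivity)).ne' measure_ball_lt_top.ne
  by_contra hinf
  obtain ⟨S, hS, hSfin, hcard⟩ := Set.Infinite.exists_subset_ncard_eq hinf c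
  have := card_mul_volume_ball_le (S := S) (B := Metric.thickening (r / 2) A) (r := r)
    (fun x hx y hy => hM x (hS hx).1 y (hS hy).1)
    (fun x hx => Metric.ball_subset_thickening (hS hx).2 _) hA.thickening hSfin
  rw [← le_div_iff₀ hv, Nat.card_coe_set_eq, hcard] at this
  linarith

/-- If `M` is Meyer with positive density `dM` along a van Hove sequence, `0 < ε < 2 dM`,
and the density of `(t + M) ∆ M` exists and is `< ε`, then `t ∈ M - M`. -/
theorem mem_sub_of_small_symmDiff_density {d : ℕ} (M : Set (EuclideanSpace ℝ (Fin d)))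
    (hM : IsMeyer M)
    (A : ℕ → Set (EuclideanSpace ℝ (Fin d))) (hA : IsVanHove A)
    (dM : ℝ) (hdM : 0 < dM)
    (hdens : Tendsto (fun m => (Nat.card ↥(M ∩ A m) : ℝ) / (volume (A m)).toReal)
      atTop (𝓝 dM))
    (ε : ℝ) (hε : 0 < ε) (hε2 : ε < 2 * dM)
    (t : EuclideanSpace ℝ (Fin d)) (L : ℝ)
    (ht : Tendsto (fun m => (Nat.card ↥(((t +ᵥ M) ∆ M) ∩ A m) : ℝ) / (volume (A m)).toReal)
      atTop (𝓝 L))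
    (hL : L < ε) :
    t ∈ M - M := by
  by_contra htM
  have hMd := hM.2.of_sub
  obtain ⟨r, hr, hsep⟩ := id hMd
  obtain ⟨-, hcpt, -, hbd⟩ := hA
  have hAb : ∀ m, Bornology.IsBounded (A m) := fun m =>
    (hcpt m).isBounded.subset subset_closure
  set v := (volume (Metric.ball (0 : EuclideanSpace ℝ (Fin d)) (r / 2))).toReal
  have hv : 0 < v :=
    ENNReal.toReal_pos (Metric.measure_ball_pos _ _ (by positivity)).ne' measure_ball_lt_top.ne
  set K := Metric.closedBall (0 : EuclideanSpace ℝ (Fin d)) (‖t‖ + r / 2)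
  have hdisj : Disjoint (t +ᵥ M) M := by
    rw [Set.disjoint_left]
    rintro _ ⟨x, hx, rfl⟩ hy
    exact htM ⟨t + x, hy, x, hx, by simp⟩
  have hcount : ∀ m, 2 * (Nat.card ↥(M ∩ A m) : ℝ) - (volume (KBoundary K (A m))).toReal / v
      ≤ Nat.card ↥(((t +ᵥ M) ∆ M) ∩ A m) := by
    intro m
    have hfin := hMd.finite_inter (hAb m)
    set S := {x ∈ M ∩ A m | t + x ∉ A m}
    set T := {x ∈ M ∩ A m | t + x ∈ A m}
    have hS : (Nat.card S : ℝ) ≤ (volume (KBoundary K (A m))).toReal / v := by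
      rw [le_div_iff₀ hv]
      exact card_mul_volume_ball_le (fun x hx y hy => hsep x hx.1.1 y hy.1.1)
        (fun x hx => ball_subset_kBoundary hx.1.2 hx.2)
        (isBounded_kBoundary Metric.isBounded_closedBall (hAb m))
        (hfin.subset (Set.sep_subset _ _))
    have hMA : (M ∩ A m).ncard ≤ S.ncard + T.ncard := by
      refine le_trans (Set.ncard_le_ncard (fun x hx => ?_) ?_) (Set.ncard_union_le S T)
      · by_cases h : t + x ∈ A m
        · exact Or.inr ⟨hx, h⟩
        · exact Or.inl ⟨hx, h⟩
      · exact (hfin.subset (Set.sep_subset _ _)).union (hfin.subset (Set.sep_subset _ _))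
    have hsd : ((t +ᵥ M) ∆ M) ∩ A m = ((t +ᵥ M) ∩ A m) ∪ (M ∩ A m) := by
      rw [hdisj.symmDiff_eq_sup]
      exact Set.union_inter_distrib_right _ _ _
    have hfin' : ((t +ᵥ M) ∩ A m).Finite := by
      refine UniformlyDiscrete.finite_inter ⟨r, hr, ?_⟩ (hAb m)
      rintro _ ⟨x, hx, rfl⟩ _ ⟨y, hy, rfl⟩ hxy
      simpa using hsep x hx y hy (fun h => hxy (by rw [h]))
    have hT : T.ncard ≤ ((t +ᵥ M) ∩ A m).ncard := by
      refine Set.ncard_le_ncard_of_injOn (fun x => t + x) ?_ (add_right_injective t).injOn hfin'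
      exact fun x hx => ⟨⟨x, hx.1.1, rfl⟩, hx.2⟩
    have hU : (((t +ᵥ M) ∆ M) ∩ A m).ncard = ((t +ᵥ M) ∩ A m).ncard + (M ∩ A m).ncard := by
      rw [hsd]
      exact Set.ncard_union_eq
        (hdisj.mono Set.inter_subset_left Set.inter_subset_left) hfin' hfin
    simp only [Nat.card_coe_set_eq] at hS ⊢
    rify at hMA hT hU
    linarith
  have hlim : Tendsto (fun m => 2 * ((Nat.card ↥(M ∩ A m) : ℝ) / (volume (A m)).toReal) -
      (volume (KBoundary K (A m))).toReal / (volume (A m)).toReal / v) atTop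
      (𝓝 (2 * dM - 0 / v)) :=
    (hdens.const_mul 2).sub ((hbd K (isCompact_closedBall _ _)).div_const v)
  have hle := le_of_tendsto_of_tendsto' hlim ht fun m => by
    refine le_of_eq_of_le ?_ (div_le_div_of_nonneg_right (hcount m) ENNReal.toReal_nonneg)
    ring
  rw [zero_div, sub_zero] at hle
  linarith
end

section
/- Let M ⊆ ℝ^d be a Delone set with finite local complexity (in particular, any Meyer set). Then the additive subgroup [M] of ℝ^d generated by M is a free abelian group of finite rank k with k ≥ d. -/
open scoped Pointwise

/-- A Delone set: relatively dense and uniformly discrete. -/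
def IsDelone {d : ℕ} (M : Set (EuclideanSpace ℝ (Fin d))) : Prop :=
  RelativelyDense M ∧ UniformlyDiscrete M

/-- The points of a relatively dense set are connected by steps of length at most `2 * R + 1`. -/
theorem sub_mem_closure_of_dist_le {d : ℕ} {M : Set (EuclideanSpace ℝ (Fin d))} {R : ℝ}
    (hR : 0 < R) (h : ∀ y : EuclideanSpace ℝ (Fin d), ∃ x ∈ M, dist x y ≤ R)
    {x₀ : EuclideanSpace ℝ (Fin d)} (hx₀ : x₀ ∈ M) (n : ℕ) :
    ∀ x ∈ M, dist x x₀ ≤ n →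
      x - x₀ ∈ AddSubgroup.closure ((M - M) ∩ Metric.closedBall 0 (2 * R + 1)) := by
  induction n with
  | zero =>
    intro x _ hd
    have hx : x = x₀ := dist_le_zero.mp (by simpa using hd)
    simp [hx]
  | succ n ih =>
    intro x hx hd
    by_cases hle : dist x x₀ ≤ 2 * R + 1
    · exact AddSubgroup.subset_closure
        ⟨Set.sub_mem_sub hx hx₀, by simpa [← dist_eq_norm] using hle⟩
    · have hlt : 2 * R + 1 < dist x x₀ := not_le.mp hle
      have hpos : 0 < dist x x₀ := by linarith
      set t : ℝ := (R + 1) / dist x x₀ with ht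
      have ht0 : 0 ≤ t := by positivity
      have ht1 : t ≤ 1 := by rw [ht, div_le_one hpos]; linarith
      have htd : t * dist x x₀ = R + 1 := by rw [ht]; field_simp
      obtain ⟨z, hz, hzy⟩ := h (AffineMap.lineMap x x₀ t)
      have h₁ : dist (AffineMap.lineMap x x₀ t) x = R + 1 := by
        rw [dist_lineMap_left, Real.norm_of_nonneg ht0, htd]
      have h₂ : dist (AffineMap.lineMap x x₀ t) x₀ = dist x x₀ - (R + 1) := by
        rw [dist_lineMap_right, Real.norm_of_nonneg (by linarith), sub_mul, htd, one_mul]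
      have hzx : dist x z ≤ 2 * R + 1 := by
        rw [dist_comm]
        linarith [dist_triangle z (AffineMap.lineMap x x₀ t) x]
      have hzx₀ : dist z x₀ ≤ n := by
        push_cast at hd
        linarith [dist_triangle z (AffineMap.lineMap x x₀ t) x₀]
      rw [← sub_add_sub_cancel x z x₀]
      exact add_mem (AddSubgroup.subset_closure
        ⟨Set.sub_mem_sub hx hz, by simpa [← dist_eq_norm] using hzx⟩) (ih z hz hzx₀)

theorem RelativelyDense.closure_fg {d : ℕ} {M : Set (EuclideanSpace ℝ (Fin d))}
    (hM : RelativelyDense M) (hFLC : FLC M) : (AddSubgroup.closure M).FG := by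
  obtain ⟨R, hR, h⟩ := hM
  obtain ⟨x₀, hx₀, -⟩ := h 0
  have hfin := hFLC _ (isCompact_closedBall 0 (2 * R + 1))
  refine (AddSubgroup.fg_iff _).mpr ⟨insert x₀ ((M - M) ∩ Metric.closedBall 0 (2 * R + 1)),
    le_antisymm ?_ ?_, hfin.insert x₀⟩
  · rw [AddSubgroup.closure_le]
    rintro _ (rfl | ⟨⟨a, ha, b, hb, rfl⟩, -⟩)
    · exact AddSubgroup.subset_closure hx₀
    · exact sub_mem (AddSubgroup.subset_closure ha) (AddSubgroup.subset_closure hb)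
  · rw [AddSubgroup.closure_le]
    intro x hx
    obtain ⟨n, hn⟩ := exists_nat_ge (dist x x₀)
    rw [← sub_add_cancel x x₀]
    exact add_mem
      (AddSubgroup.closure_mono (Set.subset_insert _ _)
        (sub_mem_closure_of_dist_le hR h hx₀ n x hx hn))
      (AddSubgroup.subset_closure (Set.mem_insert _ _))

theorem RelativelyDense.span_eq_top {d : ℕ} {M : Set (EuclideanSpace ℝ (Fin d))}
    (hM : RelativelyDense M) : Submodule.span ℝ M = ⊤ := by
  obtain ⟨R, hR, h⟩ := hM
  rw [← Submodule.orthogonal_eq_bot_iff, Submodule.eq_bot_iff]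
  intro v hv
  by_contra hv0
  have hpos : 0 < ‖v‖ := norm_pos_iff.mpr hv0
  obtain ⟨x, hx, hxy⟩ := h (((R + 1) / ‖v‖) • v)
  have hort : inner ℝ x v = 0 :=
    Submodule.inner_right_of_mem_orthogonal (Submodule.subset_span hx) hv
  have hcs := real_inner_le_norm (((R + 1) / ‖v‖) • v - x) v
  rw [inner_sub_left, hort, real_inner_smul_left, real_inner_self_eq_norm_sq, sub_zero,
    ← dist_eq_norm, dist_comm] at hcs
  have heq : (R + 1) / ‖v‖ * ‖v‖ ^ 2 = (R + 1) * ‖v‖ := by field_simp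
  rw [heq] at hcs
  linarith [le_of_mul_le_mul_right hcs hpos]

/-- The group generated by a Delone set with finite local complexity is free abelian
of finite rank `k ≥ d`. -/
theorem closure_free_of_finite_rank {d : ℕ} (M : Set (EuclideanSpace ℝ (Fin d)))
    (hM : IsDelone M) (hFLC : FLC M) :
    ∃ k : ℕ, d ≤ k ∧ Nonempty ((AddSubgroup.closure M) ≃+ (Fin k → ℤ)) := by
  have : AddGroup.FG (AddSubgroup.closure M) :=
    (AddGroup.fg_iff_addSubgroup_fg _).mpr (hM.1.closure_fg hFLC)
  have : Module.Finite ℤ (AddSubgroup.closure M) := Module.Finite.iff_addGroup_fg.mpr this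
  have : IsAddTorsionFree (EuclideanSpace ℝ (Fin d)) := .of_module_rat _
  let b := Module.finBasis ℤ (AddSubgroup.closure M)
  refine ⟨_, ?_, ⟨b.equivFun.toAddEquiv⟩⟩
  have hspan : Submodule.span ℝ (Set.range fun i => (b i : EuclideanSpace ℝ (Fin d))) = ⊤ := by
    rw [eq_top_iff, ← hM.1.span_eq_top, Submodule.span_le]
    intro x hx
    have hsum := congrArg (AddSubgroup.subtype _)
      (b.sum_repr ⟨x, AddSubgroup.subset_closure hx⟩)
    simp only [map_sum, map_zsmul, AddSubgroup.coe_subtype] at hsum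
    rw [← hsum]
    exact sum_mem fun i _ => zsmul_mem (Submodule.subset_span (Set.mem_range_self i)) _
  have hcard := finrank_range_le_card (R := ℝ) fun i => (b i : EuclideanSpace ℝ (Fin d))
  rw [Set.finrank, hspan, finrank_top] at hcard
  simpa using hcard
end
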